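/- arXiv:1211.3620 — 3 statements merged into one kernel-verified Lean document; each statement's English description precedes it below -/
import Mathlib

section
/- Let J be a real analytic almost complex structure on a neighborhood of 0 in ℝ^{2n}, let X be a real analytic vector field in a neighborhood of the origin, and let k₀ ≥ 2 be an integer. Then the following are equivalent: (i) for every 0 ≤ k ≤ k₀ − 2 and all X₁,…,X_k ∈ {X, JX}, one has X₁·(X₂·(⋯(X_k·[X,JX])))(0) = 0; (ii) X commutes at order k₀ at 0. Moreover, if (i) holds, then for all integers 0 ≤ l ≤ k ≤ k₀ − 1 and all X₁,…,X_k ∈ {X, JX}: X₁·(X₂·(⋯(X_l·[X_{l+1},[…,[X_k,[X,JX]]…]])))(0) = [X₁,[X₂,[…,[X_k,[X,JX]]…]]](0). -/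
noncomputable section

open Metric

/-- `ℝ^{2n}` identified with `ℂ^n`. -/
abbrev Ecx (n : ℕ) := EuclideanSpace ℂ (Fin n)

/-- The standard complex structure `J₀` (multiplication by `i`), as a real-linear map. -/
def J0 (n : ℕ) : Ecx n →L[ℝ] Ecx n := Complex.I • ContinuousLinearMap.id ℝ (Ecx n)

variable {F : Type*} [NormedAddCommGroup F] [NormedSpace ℝ F]

/-- `J`-holomorphy of `γ` on a set `D ⊆ ℂ`: `dγ(ζ) ∘ J_st = J(γ ζ) ∘ dγ(ζ)`. -/
def JHolOn (J : F → F →L[ℝ] F) (D : Set ℂ) (γ : ℂ → F) : Prop :=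
  ∀ ζ ∈ D, ∀ v : ℂ, fderiv ℝ γ ζ (Complex.I * v) = J (γ ζ) (fderiv ℝ γ ζ v)


/-- Lie bracket of vector fields: `[X,Y](p) = dY(p)(X(p)) − dX(p)(Y(p))`. -/
def lieVF (X Y : F → F) : F → F :=
  fun p => fderiv ℝ Y p (X p) - fderiv ℝ X p (Y p)

/-- The vector field `JX : x ↦ J(x) X(x)`. -/
def Jvf (J : F → F →L[ℝ] F) (X : F → F) : F → F := fun p => J p (X p)

/-- The flat covariant derivative `X · Y : p ↦ dY(p)(X(p))`. -/
def derVF (X Y : F → F) : F → F := fun p => fderiv ℝ Y p (X p)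

/-- `DX X Y k = D_X^{k,0} Y = X·(X·(⋯(X·Y)))` (`k` times). -/
def DX (X Y : F → F) : ℕ → (F → F)
  | 0 => Y
  | k + 1 => derVF X (DX X Y k)

/-- `applyVF [X₁,…,X_k] Z = X₁·(X₂·(⋯(X_k·Z)))`. -/
def applyVF : List (F → F) → (F → F) → (F → F)
  | [], Z => Z
  | Y :: rest, Z => derVF Y (applyVF rest Z)

/-- `nestedLie [X₁,…,X_k] Z = [X₁,[X₂,[…,[X_k, Z]…]]]`. -/
def nestedLie : List (F → F) → (F → F) → (F → F)
  | [], Z => Z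
  | Y :: rest, Z => lieVF Y (nestedLie rest Z)

/-- Selector for elements of `{X, JX}`: `pickVF X JX true = X`, `pickVF X JX false = JX`. -/
def pickVF (X Y : F → F) (b : Bool) : F → F := if b then X else Y

/-- `X` commutes at order `k` at `p`: all iterated Lie brackets of length `l` with
`2 ≤ l ≤ k` of elements of `{X, JX}` vanish at `p`. -/
def CommutesAtOrder (J : F → F →L[ℝ] F) (X : F → F) (k : ℕ) (p : F) : Prop :=
  ∀ m : ℕ, 1 ≤ m → m + 1 ≤ k → ∀ b : Fin m → Bool, ∀ c : Bool,
    nestedLie (List.ofFn fun i => pickVF X (Jvf J X) (b i))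
      (pickVF X (Jvf J X) c) p = 0

/-- `Z` vanishes at `p` to order `j` along `S`: every flat derivative of `Z` along fewer than `j`
fields of `S` vanishes at `p`. -/
def VanishesAlong (S : Set (F → F)) (p : F) (j : ℕ) (Z : F → F) : Prop :=
  ∀ L : List (F → F), (∀ Y ∈ L, Y ∈ S) → L.length < j → applyVF L Z p = 0

section Operators

theorem applyVF_append (L₁ L₂ : List (F → F)) (Z : F → F) :
    applyVF (L₁ ++ L₂) Z = applyVF L₁ (applyVF L₂ Z) := by
  induction L₁ with
  | nil => rfl
  | cons Y L ih => simp only [List.cons_append, applyVF, ih]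

theorem nestedLie_append (L₁ L₂ : List (F → F)) (Z : F → F) :
    nestedLie (L₁ ++ L₂) Z = nestedLie L₁ (nestedLie L₂ Z) := by
  induction L₁ with
  | nil => rfl
  | cons Y L ih => simp only [List.cons_append, nestedLie, ih]

theorem lieVF_self (X : F → F) : lieVF X X = 0 := by
  ext p; simp [lieVF]

theorem lieVF_swap (X Y : F → F) : lieVF Y X = -lieVF X Y := by
  ext p; simp [lieVF]

theorem lieVF_neg (X Y : F → F) : lieVF X (-Y) = -lieVF X Y := by
  ext p; simp [lieVF, fderiv_neg]; abel

theorem nestedLie_neg (L : List (F → F)) (Z : F → F) :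
    nestedLie L (-Z) = -nestedLie L Z := by
  induction L with
  | nil => rfl
  | cons Y L ih => simp only [nestedLie, ih, lieVF_neg]

theorem nestedLie_zero (L : List (F → F)) : nestedLie L (0 : F → F) = 0 := by
  induction L with
  | nil => rfl
  | cons Y L ih => ext p; simp [nestedLie, ih, lieVF]

theorem derVF_congr {p : F} {Z Z' : F → F} (Y : F → F) (h : Z =ᶠ[nhds p] Z') :
    derVF Y Z =ᶠ[nhds p] derVF Y Z' := by
  filter_upwards [h.fderiv (𝕜 := ℝ)] with q hq
  simp only [derVF, hq]

theorem applyVF_congr {p : F} {Z Z' : F → F} (L : List (F → F)) (h : Z =ᶠ[nhds p] Z') :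
    applyVF L Z =ᶠ[nhds p] applyVF L Z' := by
  induction L with
  | nil => exact h
  | cons Y L ih => exact derVF_congr Y ih

theorem AnalyticAt.continuousLinearMap_apply {G : Type*} [NormedAddCommGroup G]
    [NormedSpace ℝ G] {p : F} {A : F → F →L[ℝ] G} {Z : F → F} (hA : AnalyticAt ℝ A p)
    (hZ : AnalyticAt ℝ Z p) : AnalyticAt ℝ (fun q => A q (Z q)) p :=
  ((ContinuousLinearMap.id ℝ (F →L[ℝ] G)).analyticAt_bilinear (A p, Z p)).comp₂ hA hZ

variable [CompleteSpace F]

theorem derVF_sub {p : F} {Z Z' : F → F} (Y : F → F) (hZ : AnalyticAt ℝ Z p)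
    (hZ' : AnalyticAt ℝ Z' p) :
    derVF Y (Z - Z') =ᶠ[nhds p] derVF Y Z - derVF Y Z' := by
  filter_upwards [hZ.eventually_analyticAt, hZ'.eventually_analyticAt] with q hq hq'
  simp [derVF, fderiv_sub hq.differentiableAt hq'.differentiableAt]

theorem derVF_clm_apply {p : F} {A : F → F →L[ℝ] F} {Z : F → F} (Y : F → F)
    (hA : AnalyticAt ℝ A p) (hZ : AnalyticAt ℝ Z p) :
    derVF Y (fun q => A q (Z q)) =ᶠ[nhds p]
      (fun q => A q (derVF Y Z q)) - fun q => (-fderiv ℝ A q (Y q)) (Z q) := by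
  filter_upwards [hA.eventually_analyticAt, hZ.eventually_analyticAt] with q hq hq'
  simp [derVF, fderiv_clm_apply hq.differentiableAt hq'.differentiableAt]

theorem analyticAt_derVF {p : F} {Y Z : F → F} (hY : AnalyticAt ℝ Y p)
    (hZ : AnalyticAt ℝ Z p) : AnalyticAt ℝ (derVF Y Z) p :=
  hZ.fderiv.continuousLinearMap_apply hY

theorem analyticAt_lieVF {p : F} {Y Z : F → F} (hY : AnalyticAt ℝ Y p)
    (hZ : AnalyticAt ℝ Z p) : AnalyticAt ℝ (lieVF Y Z) p :=
  (analyticAt_derVF hY hZ).sub (analyticAt_derVF hZ hY)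

theorem analyticAt_applyVF {p : F} {Z : F → F} (hZ : AnalyticAt ℝ Z p) (L : List (F → F))
    (hL : ∀ Y ∈ L, AnalyticAt ℝ Y p) : AnalyticAt ℝ (applyVF L Z) p := by
  induction L with
  | nil => exact hZ
  | cons Y L ih =>
    simp only [List.forall_mem_cons] at hL
    exact analyticAt_derVF hL.1 (ih hL.2)

theorem analyticAt_nestedLie {p : F} {Z : F → F} (hZ : AnalyticAt ℝ Z p) (L : List (F → F))
    (hL : ∀ Y ∈ L, AnalyticAt ℝ Y p) : AnalyticAt ℝ (nestedLie L Z) p := by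
  induction L with
  | nil => exact hZ
  | cons Y L ih =>
    simp only [List.forall_mem_cons] at hL
    exact analyticAt_lieVF hL.1 (ih hL.2)

theorem applyVF_sub {p : F} {Z Z' : F → F} (hZ : AnalyticAt ℝ Z p) (hZ' : AnalyticAt ℝ Z' p)
    (L : List (F → F)) (hL : ∀ Y ∈ L, AnalyticAt ℝ Y p) :
    applyVF L (Z - Z') =ᶠ[nhds p] applyVF L Z - applyVF L Z' := by
  induction L with
  | nil => rfl
  | cons Y L ih =>
    simp only [List.forall_mem_cons] at hL
    exact (derVF_congr Y (ih hL.2)).trans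
      (derVF_sub Y (analyticAt_applyVF hZ L hL.2) (analyticAt_applyVF hZ' L hL.2))

end Operators

namespace VanishesAlong

variable {S : Set (F → F)} {p : F} {j : ℕ} {Z Z' : F → F}

theorem mono (h : VanishesAlong S p j Z) {i : ℕ} (hij : i ≤ j) : VanishesAlong S p i Z :=
  fun L hL hlen => h L hL (hlen.trans_le hij)

theorem congr (h : VanishesAlong S p j Z) (hZ : Z =ᶠ[nhds p] Z') : VanishesAlong S p j Z' :=
  fun L hL hlen => (applyVF_congr L hZ).eq_of_nhds ▸ h L hL hlen

theorem derVF {Y : F → F} (hY : Y ∈ S) (h : VanishesAlong S p j Z) :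
    VanishesAlong S p (j - 1) (derVF Y Z) := by
  intro L hL hlen
  have := h (L ++ [Y]) (by simpa [or_imp, forall_and, hY] using hL) (by simp; omega)
  rwa [applyVF_append] at this

theorem of_derVF (h0 : Z p = 0) (h : ∀ Y ∈ S, VanishesAlong S p j (_root_.derVF Y Z)) :
    VanishesAlong S p (j + 1) Z := by
  intro L hL hlen
  rcases L.eq_nil_or_concat' with rfl | ⟨L, Y, rfl⟩
  · exact h0
  · rw [applyVF_append]
    exact h Y (hL Y (by simp)) L (fun Y' hY' => hL Y' (by simp [hY'])) (by simpa using hlen)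

variable [CompleteSpace F]

theorem sub (hS : ∀ Y ∈ S, AnalyticAt ℝ Y p) (hZ : AnalyticAt ℝ Z p) (hZ' : AnalyticAt ℝ Z' p)
    (h : VanishesAlong S p j Z) (h' : VanishesAlong S p j Z') :
    VanishesAlong S p j (Z - Z') := by
  intro L hL hlen
  rw [(applyVF_sub hZ hZ' L fun Y hY => hS Y (hL Y hY)).eq_of_nhds, Pi.sub_apply,
    h L hL hlen, h' L hL hlen, sub_zero]

theorem clm_apply (hS : ∀ Y ∈ S, AnalyticAt ℝ Y p) {A : F → F →L[ℝ] F}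
    (hA : AnalyticAt ℝ A p) (hZ : AnalyticAt ℝ Z p) (h : VanishesAlong S p j Z) :
    VanishesAlong S p j (fun q => A q (Z q)) := by
  induction j generalizing A Z with
  | zero => intro L _ hlen; simp at hlen
  | succ j ih =>
    refine of_derVF ?_ fun Y hY => ?_
    · have : Z p = 0 := h [] (by simp) (by simp)
      simp [this]
    · have hYan := hS Y hY
      have hB : AnalyticAt ℝ (fun q => -fderiv ℝ A q (Y q)) p := (hA.fderiv.continuousLinearMap_apply hYan).neg
      have hYZ := analyticAt_derVF hYan hZ
      exact (sub hS (hA.continuousLinearMap_apply hYZ) (hB.continuousLinearMap_apply hZ) (ih hA hYZ (h.derVF hY))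
        (ih hB hZ (h.mono j.le_succ))).congr (derVF_clm_apply Y hA hZ).symm

theorem nestedLie (hS : ∀ Y ∈ S, AnalyticAt ℝ Y p) (hZ : AnalyticAt ℝ Z p)
    (h : VanishesAlong S p j Z) (L : List (F → F)) (hL : ∀ Y ∈ L, Y ∈ S) :
    VanishesAlong S p (j - L.length) (nestedLie L Z) := by
  induction L with
  | nil => exact h
  | cons Y L ih =>
    simp only [List.forall_mem_cons] at hL
    have hY := hS Y hL.1
    have hN := analyticAt_nestedLie hZ L fun Y hY => hS Y (hL.2 Y hY)
    exact sub hS (analyticAt_derVF hY hN) (analyticAt_derVF hN hY)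
      (((ih hL.2).derVF hL.1).mono (by simp; omega))
      ((clm_apply hS hY.fderiv hN (ih hL.2)).mono (by simp; omega))

/-- Nested brackets and iterated flat derivatives agree to one order higher than the order to
which either of them vanishes. -/
theorem nestedLie_sub_applyVF (hS : ∀ Y ∈ S, AnalyticAt ℝ Y p) (hZ : AnalyticAt ℝ Z p)
    (h : VanishesAlong S p j Z) (L : List (F → F)) (hL : ∀ Y ∈ L, Y ∈ S) :
    VanishesAlong S p (j + 1 - L.length) (_root_.nestedLie L Z - applyVF L Z) := by
  induction L with
  | nil =>
    intro L hL _
    have := (applyVF_sub hZ hZ L fun Y hY => hS Y (hL Y hY)).eq_of_nhds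
    simpa [_root_.nestedLie, applyVF] using this
  | cons Y L ih =>
    simp only [List.forall_mem_cons] at hL
    have hY := hS Y hL.1
    have hLan : ∀ Y ∈ L, AnalyticAt ℝ Y p := fun Y hY => hS Y (hL.2 Y hY)
    have hN := analyticAt_nestedLie hZ L hLan
    have hA := analyticAt_applyVF hZ L hLan
    refine (sub hS (analyticAt_derVF hY (hN.sub hA)) (analyticAt_derVF hN hY)
      (((ih hL.2).derVF hL.1).mono (by simp; omega))
      ((clm_apply hS hY.fderiv hN (h.nestedLie hS hZ L hL.2)).mono (by simp))).congr ?_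
    filter_upwards [derVF_sub Y hN hA] with q hq
    rw [Pi.sub_apply, hq]
    simp only [Pi.sub_apply, _root_.nestedLie, applyVF, lieVF, _root_.derVF]
    abel

theorem applyVF_nestedLie_eq (hS : ∀ Y ∈ S, AnalyticAt ℝ Y p) (hZ : AnalyticAt ℝ Z p)
    (h : VanishesAlong S p j Z) (L₁ L₂ : List (F → F)) (hL₁ : ∀ Y ∈ L₁, Y ∈ S)
    (hL₂ : ∀ Y ∈ L₂, Y ∈ S) (hlen : L₁.length + L₂.length ≤ j) :
    applyVF L₁ (_root_.nestedLie L₂ Z) p = applyVF (L₁ ++ L₂) Z p := by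
  have hL₂an : ∀ Y ∈ L₂, AnalyticAt ℝ Y p := fun Y hY => hS Y (hL₂ Y hY)
  have h0 := h.nestedLie_sub_applyVF hS hZ L₂ hL₂ L₁ hL₁ (by omega)
  rw [(applyVF_sub (analyticAt_nestedLie hZ L₂ hL₂an) (analyticAt_applyVF hZ L₂ hL₂an) L₁
    fun Y hY => hS Y (hL₁ Y hY)).eq_of_nhds, Pi.sub_apply, sub_eq_zero] at h0
  rw [h0, applyVF_append]

/-- Under vanishing to order `j`, leading brackets in a nest of length at most `j` may be replaced
by flat derivatives. -/
theorem applyVF_nestedLie_eq_nestedLie (hS : ∀ Y ∈ S, AnalyticAt ℝ Y p)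
    (hZ : AnalyticAt ℝ Z p) (h : VanishesAlong S p j Z) (L₁ L₂ : List (F → F))
    (hL₁ : ∀ Y ∈ L₁, Y ∈ S) (hL₂ : ∀ Y ∈ L₂, Y ∈ S) (hlen : L₁.length + L₂.length ≤ j) :
    applyVF L₁ (_root_.nestedLie L₂ Z) p = _root_.nestedLie (L₁ ++ L₂) Z p := by
  rw [h.applyVF_nestedLie_eq hS hZ L₁ L₂ hL₁ hL₂ hlen]
  refine (h.applyVF_nestedLie_eq hS hZ [] (L₁ ++ L₂) (by simp) ?_ (by simpa using hlen)).symm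
  intro Y hY
  exact (List.mem_append.1 hY).elim (hL₁ Y) (hL₂ Y)

theorem iff_nestedLie (hS : ∀ Y ∈ S, AnalyticAt ℝ Y p) (hZ : AnalyticAt ℝ Z p) :
    VanishesAlong S p j Z ↔
      ∀ L : List (F → F), (∀ Y ∈ L, Y ∈ S) → L.length < j → _root_.nestedLie L Z p = 0 := by
  constructor
  · intro h L hL hlen
    exact h.nestedLie hS hZ L hL [] (by simp) (by simp; omega)
  · induction j with
    | zero => intro _ L _ hlen; simp at hlen
    | succ j ih =>
      intro h L hL hlen
      have hj := ih fun L hL hlen => h L hL (by omega)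
      have := hj.applyVF_nestedLie_eq_nestedLie hS hZ L [] hL (by simp) (by simp; omega)
      simp only [List.append_nil, _root_.nestedLie] at this
      rw [this, h L hL hlen]

end VanishesAlong

theorem forall_list_mem_range_iff_ofFn {α β : Type*} (f : α → β) (P : List β → Prop) :
    (∀ L : List β, (∀ y ∈ L, y ∈ Set.range f) → P L) ↔
      ∀ (k : ℕ) (b : Fin k → α), P (List.ofFn fun i => f (b i)) := by
  constructor
  · intro h k b
    exact h _ (by simp [List.mem_ofFn])
  · intro h L hL
    obtain ⟨l, rfl⟩ : L ∈ Set.range (List.map f) := by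
      rw [Set.range_list_map]; exact hL
    simpa [List.ofFn_get, ← List.map_ofFn, Function.comp_def] using h l.length l.get

theorem commutesAtOrder_iff_nestedLie (J : F → F →L[ℝ] F) (X : F → F) (k : ℕ) (p : F) :
    CommutesAtOrder J X k p ↔
      ∀ L : List (F → F), (∀ Y ∈ L, Y ∈ Set.range (pickVF X (Jvf J X))) → L.length < k - 1 →
        nestedLie L (lieVF X (Jvf J X)) p = 0 := by
  have key : CommutesAtOrder J X k p ↔
      ∀ L : List (F → F), (∀ Y ∈ L, Y ∈ Set.range (pickVF X (Jvf J X))) →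
        1 ≤ L.length → L.length + 1 ≤ k → ∀ c : Bool, nestedLie L (pickVF X (Jvf J X) c) p = 0 := by
    rw [forall_list_mem_range_iff_ofFn (pickVF X (Jvf J X)) fun L =>
      1 ≤ L.length → L.length + 1 ≤ k → ∀ c : Bool, nestedLie L (pickVF X (Jvf J X) c) p = 0]
    simp only [List.length_ofFn]
    exact ⟨fun h m b h1 h2 c => h m h1 h2 b c, fun h m h1 h2 b c => h m b h1 h2 c⟩
  rw [key]
  constructor
  · intro h L hL hlen
    have := h (L ++ [X]) (by
      intro Y hY
      rcases List.mem_append.1 hY with hY | hY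
      · exact hL Y hY
      · exact ⟨true, (List.mem_singleton.1 hY).symm⟩) (by simp)
      (by simp; omega) false
    rwa [nestedLie_append] at this
  · intro h L hL h1 h2 c
    rcases L.eq_nil_or_concat' with rfl | ⟨L, Y, rfl⟩
    · simp at h1
    · obtain ⟨b, rfl⟩ := hL Y (by simp)
      have h0 := h L (fun Y hY => hL Y (by simp [hY])) (by simp at h2; omega)
      rw [nestedLie_append]
      cases b <;> cases c <;> simp only [nestedLie, pickVF, if_true, Bool.false_eq_true, if_false]
      · simp [lieVF_self, nestedLie_zero]
      · rw [lieVF_swap, nestedLie_neg, Pi.neg_apply, h0, neg_zero]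
      · exact h0
      · simp [lieVF_self, nestedLie_zero]

/-- Proposition 4.1. -/
theorem stmt9 (n : ℕ) (U : Set (Ecx n)) (hU : IsOpen U) (h0U : (0 : Ecx n) ∈ U)
    (J : Ecx n → Ecx n →L[ℝ] Ecx n) (hJan : AnalyticOnNhd ℝ J U)
    (hJsq : ∀ x ∈ U, (J x).comp (J x) = -ContinuousLinearMap.id ℝ (Ecx n))
    (X : Ecx n → Ecx n) (hXan : AnalyticOnNhd ℝ X U)
    (k₀ : ℕ) (hk₀ : 2 ≤ k₀) :
    ((∀ k : ℕ, k ≤ k₀ - 2 → ∀ b : Fin k → Bool,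
        applyVF (List.ofFn fun i => pickVF X (Jvf J X) (b i)) (lieVF X (Jvf J X)) 0 = 0)
      ↔ CommutesAtOrder J X k₀ 0) ∧
    ((∀ k : ℕ, k ≤ k₀ - 2 → ∀ b : Fin k → Bool,
        applyVF (List.ofFn fun i => pickVF X (Jvf J X) (b i)) (lieVF X (Jvf J X)) 0 = 0) →
      ∀ k : ℕ, k ≤ k₀ - 1 → ∀ b : Fin k → Bool, ∀ l : ℕ, l ≤ k →
        applyVF ((List.ofFn fun i => pickVF X (Jvf J X) (b i)).take l)
          (nestedLie ((List.ofFn fun i => pickVF X (Jvf J X) (b i)).drop l)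
            (lieVF X (Jvf J X))) 0
        = nestedLie (List.ofFn fun i => pickVF X (Jvf J X) (b i)) (lieVF X (Jvf J X)) 0) := by
  have hX0 : AnalyticAt ℝ X 0 := hXan 0 h0U
  have hJX0 : AnalyticAt ℝ (Jvf J X) 0 := (hJan 0 h0U).continuousLinearMap_apply hX0
  have hW := analyticAt_lieVF hX0 hJX0
  have hS : ∀ Y ∈ Set.range (pickVF X (Jvf J X)), AnalyticAt ℝ Y 0 := by
    rintro _ ⟨b, rfl⟩
    cases b
    · exact hJX0
    · exact hX0
  have hvan : (∀ k : ℕ, k ≤ k₀ - 2 → ∀ b : Fin k → Bool,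
      applyVF (List.ofFn fun i => pickVF X (Jvf J X) (b i)) (lieVF X (Jvf J X)) 0 = 0) ↔
      VanishesAlong (Set.range (pickVF X (Jvf J X))) 0 (k₀ - 1) (lieVF X (Jvf J X)) := by
    rw [VanishesAlong, forall_list_mem_range_iff_ofFn (pickVF X (Jvf J X)) fun L =>
      L.length < k₀ - 1 → applyVF L (lieVF X (Jvf J X)) 0 = 0]
    simp only [List.length_ofFn]
    exact ⟨fun h k b hk => h k (by omega) b, fun h k hk b => h k b (by omega)⟩
  rw [hvan]
  refine ⟨?_, fun h k hk b l hl => ?_⟩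
  · rw [VanishesAlong.iff_nestedLie hS hW, commutesAtOrder_iff_nestedLie]
  · set L := List.ofFn fun i => pickVF X (Jvf J X) (b i) with hLdef
    have hL : ∀ Y ∈ L, Y ∈ Set.range (pickVF X (Jvf J X)) := by
      intro Y hY
      obtain ⟨i, rfl⟩ := List.mem_ofFn.1 hY
      exact ⟨b i, rfl⟩
    have hlen : L.length = k := List.length_ofFn
    have := h.applyVF_nestedLie_eq_nestedLie hS hW (L.take l) (L.drop l)
      (fun Y hY => hL Y (List.mem_of_mem_take hY)) (fun Y hY => hL Y (List.mem_of_mem_drop hY))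
      (by simp only [List.length_take, List.length_drop]; omega)
    rwa [List.take_append_drop] at this
end
end

section
/- Let m ≥ 1, R > 0 and r ∈ (0,R). Let F : ℂ^m → ℂ be holomorphic on the open polydisc {z ∈ ℂ^m : |z_i| < R for all i} and continuous and bounded on its closure, with ‖F‖_∞ the supremum of |F| over the closed polydisc. For i = 1,…,m let f_i : 𝔻 → ℂ (𝔻 the open unit disc) admit an expansion f_i(ζ) = ∑_{k,l ≥ 0} c^{(i)}_{k,l} ζ^k ζ̄^l with ∑_{k,l} (1+k)|c^{(i)}_{k,l}| < r. Then the function ζ ↦ F(f₁(ζ),…,f_m(ζ)) admits an expansion ∑_{k,l ≥ 0} h_{k,l} ζ^k ζ̄^l on 𝔻 with ∑_{k,l} (1+k)|h_{k,l}| ≤ (R/(R−r))^m · ‖F‖_∞. -/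
open Metric

/-- `u` has an expansion `∑ h_{k,l} ζ ^ k (conj ζ) ^ l` on the open unit disc whose weighted
`ℓ¹` norm `∑ (1 + k) ‖h_{k,l}‖` is at most `M`. -/
def HasWeightedExpansion (u : ℂ → ℂ) (M : ℝ) : Prop :=
  ∃ h : ℕ × ℕ → ℂ, Summable (fun p => (1 + p.1 : ℝ) * ‖h p‖) ∧
    (∑' p, (1 + p.1 : ℝ) * ‖h p‖) ≤ M ∧
    ∀ ζ ∈ ball (0 : ℂ) 1, u ζ = ∑' p, h p * ζ ^ p.1 * (starRingEnd ℂ ζ) ^ p.2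

theorem norm_monomial_le_weight (c : ℂ) (p : ℕ × ℕ) {ζ : ℂ} (hζ : ζ ∈ ball (0 : ℂ) 1) :
    ‖c * ζ ^ p.1 * (starRingEnd ℂ ζ) ^ p.2‖ ≤ (1 + p.1 : ℝ) * ‖c‖ := by
  have hζ' : ‖ζ‖ ≤ 1 := (mem_ball_zero_iff.1 hζ).le
  rw [norm_mul, norm_mul, norm_pow, norm_pow, RCLike.norm_conj]
  calc ‖c‖ * ‖ζ‖ ^ p.1 * ‖ζ‖ ^ p.2 ≤ ‖c‖ * 1 * 1 := by
        gcongr <;> exact pow_le_one₀ (norm_nonneg _) hζ'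
    _ ≤ (1 + p.1 : ℝ) * ‖c‖ := by
        rw [mul_one, mul_one]
        exact le_mul_of_one_le_left (norm_nonneg _) (by simp)

theorem summable_monomial {ι : Type*} {g : ι → ℂ} {e : ι → ℕ × ℕ}
    (hg : Summable fun i => (1 + (e i).1 : ℝ) * ‖g i‖) {ζ : ℂ} (hζ : ζ ∈ ball (0 : ℂ) 1) :
    Summable fun i => ‖g i * ζ ^ (e i).1 * (starRingEnd ℂ ζ) ^ (e i).2‖ :=
  hg.of_nonneg_of_le (fun _ => norm_nonneg _) fun _ => norm_monomial_le_weight _ _ hζ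

namespace HasWeightedExpansion

variable {u v : ℂ → ℂ} {M N : ℝ}

theorem of_family {ι : Type*} {g : ι → ℂ} {e : ι → ℕ × ℕ}
    (hg : Summable fun i => (1 + (e i).1 : ℝ) * ‖g i‖)
    (hM : ∑' i, (1 + (e i).1 : ℝ) * ‖g i‖ ≤ M)
    (hu : ∀ ζ ∈ ball (0 : ℂ) 1, u ζ = ∑' i, g i * ζ ^ (e i).1 * (starRingEnd ℂ ζ) ^ (e i).2) :
    HasWeightedExpansion u M := by
  have hfib := hg.hasSum.tsum_fiberwise e
  have hle : ∀ p : ℕ × ℕ, (1 + p.1 : ℝ) * ‖∑' i : e ⁻¹' {p}, g i‖ ≤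
      ∑' i : e ⁻¹' {p}, (1 + (e i).1 : ℝ) * ‖g i‖ := by
    intro p
    have hs : Summable fun i : e ⁻¹' {p} => ‖g i‖ :=
      (hg.subtype (e ⁻¹' {p})).of_nonneg_of_le (fun _ => norm_nonneg _) fun _ =>
        le_mul_of_one_le_left (norm_nonneg _) (by simp)
    have heq : ∀ i : e ⁻¹' {p}, (1 + (e i).1 : ℝ) * ‖g i‖ = (1 + p.1 : ℝ) * ‖g i‖ := by
      rintro ⟨i, rfl⟩
      rfl
    rw [tsum_congr heq, tsum_mul_left]
    gcongr
    exact norm_tsum_le_tsum_norm hs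
  have hs : Summable fun p : ℕ × ℕ => (1 + p.1 : ℝ) * ‖∑' i : e ⁻¹' {p}, g i‖ :=
    hfib.summable.of_nonneg_of_le (fun _ => by positivity) hle
  refine ⟨fun p => ∑' i : e ⁻¹' {p}, g i, hs, ?_, fun ζ hζ => ?_⟩
  · exact ((hs.tsum_le_tsum hle hfib.summable).trans_eq hfib.tsum_eq).trans hM
  · rw [hu ζ hζ, ← ((summable_monomial hg hζ).of_norm.hasSum.tsum_fiberwise e).tsum_eq]
    refine tsum_congr fun p => ?_
    rw [← tsum_mul_right, ← tsum_mul_right]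
    refine tsum_congr ?_
    rintro ⟨i, rfl⟩
    rfl

theorem nonneg (hu : HasWeightedExpansion u M) : 0 ≤ M := by
  obtain ⟨h, -, hM, -⟩ := hu
  exact (tsum_nonneg fun _ => by positivity).trans hM

theorem norm_le (hu : HasWeightedExpansion u M) {ζ : ℂ} (hζ : ζ ∈ ball (0 : ℂ) 1) :
    ‖u ζ‖ ≤ M := by
  obtain ⟨h, hs, hM, hexp⟩ := hu
  have hn := summable_monomial (e := fun p => p) hs hζ
  rw [hexp ζ hζ]
  exact (norm_tsum_le_tsum_norm hn).trans
    ((hn.tsum_le_tsum (fun p => norm_monomial_le_weight _ _ hζ) hs).trans hM)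

theorem const (c : ℂ) : HasWeightedExpansion (fun _ => c) ‖c‖ :=
  of_family (ι := Unit) (g := fun _ => c) (e := fun _ => (0, 0)) (hasSum_unique _).summable
    (by simp) (by simp)

theorem mul (hu : HasWeightedExpansion u M) (hv : HasWeightedExpansion v N) :
    HasWeightedExpansion (fun ζ => u ζ * v ζ) (M * N) := by
  have hM₀ := hu.nonneg
  obtain ⟨a, ha, haM, hua⟩ := hu
  obtain ⟨b, hb, hbN, hvb⟩ := hv
  have hle : ∀ q : (ℕ × ℕ) × (ℕ × ℕ), (1 + ((q.1 + q.2).1 : ℕ) : ℝ) * ‖a q.1 * b q.2‖ ≤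
      ((1 + q.1.1 : ℝ) * ‖a q.1‖) * ((1 + q.2.1 : ℝ) * ‖b q.2‖) := by
    intro q
    rw [norm_mul, mul_mul_mul_comm]
    gcongr
    rw [Prod.fst_add]
    push_cast
    nlinarith [mul_nonneg (Nat.cast_nonneg (α := ℝ) q.1.1) (Nat.cast_nonneg (α := ℝ) q.2.1)]
  have hab := ha.mul_of_nonneg hb (fun _ => by positivity) (fun _ => by positivity)
  have hs := hab.of_nonneg_of_le (fun _ => by positivity) hle
  refine of_family (g := fun q : (ℕ × ℕ) × (ℕ × ℕ) => a q.1 * b q.2) (e := fun q => q.1 + q.2)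
    hs ?_ fun ζ hζ => ?_
  · calc _ ≤ _ := hs.tsum_le_tsum hle hab
      _ = _ := (ha.tsum_mul_tsum hb hab).symm
      _ ≤ M * N := mul_le_mul haM hbN (tsum_nonneg fun _ => by positivity) hM₀
  · rw [hua ζ hζ, hvb ζ hζ, tsum_mul_tsum_of_summable_norm
      (summable_monomial (e := fun p => p) ha hζ) (summable_monomial (e := fun p => p) hb hζ)]
    refine tsum_congr fun q => ?_
    simp only [Prod.fst_add, Prod.snd_add, pow_add]
    ring

theorem pow (hu : HasWeightedExpansion u M) (n : ℕ) :
    HasWeightedExpansion (fun ζ => u ζ ^ n) (M ^ n) := by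
  induction n with
  | zero => simpa using const 1
  | succ n ih => simpa only [pow_succ] using ih.mul hu

theorem prod {ι : Type*} (s : Finset ι) {u : ι → ℂ → ℂ} {M : ι → ℝ}
    (hu : ∀ i, HasWeightedExpansion (u i) (M i)) :
    HasWeightedExpansion (fun ζ => ∏ i ∈ s, u i ζ) (∏ i ∈ s, M i) := by
  classical
  induction s using Finset.induction_on with
  | empty => simpa using const 1
  | insert i s hi ih => simpa only [Finset.prod_insert hi] using (hu i).mul ih

theorem tsum {A : Type*} {U : A → ℂ → ℂ} {K : A → ℝ}
    (hU : ∀ α, HasWeightedExpansion (U α) (K α)) (hK : Summable K) (hM : ∑' α, K α ≤ M)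
    (hu : ∀ ζ ∈ ball (0 : ℂ) 1, u ζ = ∑' α, U α ζ) : HasWeightedExpansion u M := by
  choose h hs hle hexp using hU
  have hs' : Summable fun α => ∑' p, (1 + p.1 : ℝ) * ‖h α p‖ :=
    hK.of_nonneg_of_le (fun _ => tsum_nonneg fun _ => by positivity) hle
  have hsum : Summable fun q : A × (ℕ × ℕ) => (1 + q.2.1 : ℝ) * ‖h q.1 q.2‖ :=
    (summable_prod_of_nonneg fun _ => by positivity).2 ⟨hs, hs'⟩
  refine of_family (g := fun q : A × (ℕ × ℕ) => h q.1 q.2) (e := fun q => q.2) hsum ?_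
    fun ζ hζ => ?_
  · rw [hsum.tsum_prod]
    exact (hs'.tsum_le_tsum hle hK).trans hM
  · rw [hu ζ hζ, (summable_monomial hsum hζ).of_norm.tsum_prod]
    exact tsum_congr fun α => hexp α ζ hζ

end HasWeightedExpansion

theorem summable_and_tsum_pi_prod {K : Type*} [NormedField K] [CompleteSpace K] (m : ℕ)
    (g : Fin m → ℕ → K) (hg : ∀ i, Summable fun n => ‖g i n‖) :
    (Summable fun α : Fin m → ℕ => ‖∏ i, g i (α i)‖) ∧
      ∑' α : Fin m → ℕ, ∏ i, g i (α i) = ∏ i, ∑' n, g i n := by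
  induction m with
  | zero => exact ⟨(hasSum_unique _).summable, by simp⟩
  | succ m ih =>
    obtain ⟨hs, ht⟩ := ih (fun i => g i.succ) fun i => hg i.succ
    let e : ℕ × (Fin m → ℕ) ≃ (Fin (m + 1) → ℕ) := Fin.consEquiv fun _ => ℕ
    have hsplit : ∀ q : ℕ × (Fin m → ℕ),
        ∏ i, g i (e q i) = g 0 q.1 * ∏ i : Fin m, g i.succ (q.2 i) := by
      intro q
      simp [Fin.prod_univ_succ, e, Fin.consEquiv]
    constructor
    · refine e.summable_iff.1 (((hg 0).mul_norm hs).congr fun q => ?_)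
      rw [Function.comp_apply, hsplit]
    · rw [← e.tsum_eq, tsum_congr hsplit,
        ← tsum_mul_tsum_of_summable_norm (hg 0) hs, ht, Fin.prod_univ_succ]

theorem continuous_torusMap {m : ℕ} (c : Fin m → ℂ) (R : Fin m → ℝ) :
    Continuous (torusMap c R) := by
  unfold torusMap
  fun_prop

theorem continuous_torusMap_apply {m : ℕ} (c : Fin m → ℂ) (R : Fin m → ℝ) (i : Fin m) :
    Continuous fun θ => torusMap c R θ i :=
  (continuous_apply i).comp (continuous_torusMap c R)

theorem norm_torusMap_zero {m : ℕ} {ρ : ℝ} (hρ : 0 ≤ ρ) (θ : Fin m → ℝ) (i : Fin m) :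
    ‖torusMap 0 (fun _ => ρ) θ i‖ = ρ := by
  simp [torusMap, abs_of_nonneg hρ]

theorem torusIntegral_cauchy_kernel {m : ℕ} {R ρ : ℝ} (hρ : 0 < ρ) (hρR : ρ < R)
    {F : (Fin m → ℂ) → ℂ} (hF : DifferentiableOn ℂ F {z | ∀ i, ‖z i‖ < R})
    {z : Fin m → ℂ} (hz : ∀ i, ‖z i‖ < ρ) :
    torusIntegral (fun w => (∏ i, (w i - z i)⁻¹) * F w) 0 (fun _ => ρ) =
      (2 * Real.pi * Complex.I) ^ m * F z := by
  induction m with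
  | zero =>
    rw [torusIntegral_dim0]
    simp [Subsingleton.elim (0 : Fin 0 → ℂ) z]
  | succ m ih =>
    have hint : TorusIntegrable (fun w => (∏ i, (w i - z i)⁻¹) * F w) 0 (fun _ => ρ) := by
      refine Continuous.integrableOn_Icc (Continuous.mul ?_ ?_)
      · refine continuous_finsetProd _ fun i _ => Continuous.inv₀ ?_ fun θ h => ?_
        · exact (continuous_torusMap_apply _ _ i).sub continuous_const
        · have := norm_torusMap_zero hρ.le θ i
          rw [sub_eq_zero.1 h] at this
          exact (hz i).ne this
      · refine hF.continuousOn.comp_continuous (continuous_torusMap _ _) fun θ i => ?_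
        rwa [norm_torusMap_zero hρ.le]
    have hinner : ∀ x ∈ sphere (0 : ℂ) ρ,
        torusIntegral (fun y => (∏ i, ((Fin.cons x y : Fin (m + 1) → ℂ) i - z i)⁻¹) *
          F (Fin.cons x y)) 0 (fun _ => ρ) =
        (x - z 0)⁻¹ • ((2 * Real.pi * Complex.I) ^ m * F (Fin.cons x (Fin.tail z))) := by
      intro x hx
      have hx' : ‖x‖ < R := by rwa [mem_sphere_zero_iff_norm.1 hx]
      have hd : DifferentiableOn ℂ (fun y : Fin m → ℂ => F (Fin.cons x y))
          {y | ∀ i, ‖y i‖ < R} := by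
        refine hF.comp (Differentiable.differentiableOn ?_) fun y hy i => ?_
        · refine differentiable_pi.2 fun i => ?_
          refine Fin.cases ?_ (fun j => ?_) i
          · simp
          · simp only [Fin.cons_succ]
            fun_prop
        · refine Fin.cases ?_ (fun j => ?_) i
          · simpa using hx'
          · simpa using hy j
      rw [smul_eq_mul, ← ih hd (z := Fin.tail z) fun i => hz i.succ, ← torusIntegral_const_mul]
      simp only [Fin.prod_univ_succ, Fin.cons_zero, Fin.cons_succ, Fin.tail, mul_assoc]
    rw [torusIntegral_succ hint]
    calc _ = ∮ x in C(0, ρ), (x - z 0)⁻¹ •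
          ((2 * Real.pi * Complex.I) ^ m * F (Fin.cons x (Fin.tail z))) :=
          circleIntegral.integral_congr hρ.le hinner
      _ = _ := by
          rw [DifferentiableOn.circleIntegral_sub_inv_smul ?_ (by simpa using hz 0),
            smul_eq_mul, Fin.cons_self_tail, pow_succ]
          · ring
          refine DifferentiableOn.const_mul ?_ _
          refine hF.comp (Differentiable.differentiableOn ?_) fun x hx i => ?_
          · refine differentiable_pi.2 fun i => ?_
            refine Fin.cases ?_ (fun j => ?_) i <;> simp
          · refine Fin.cases ?_ (fun j => ?_) i
            · simpa using (mem_closedBall_zero_iff.1 hx).trans_lt hρR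
            · simpa [Fin.tail] using (hz j.succ).trans hρR

theorem exists_hasSum_on_polydisc {m : ℕ} {R ρ C : ℝ} (hρ : 0 < ρ) (hρR : ρ < R)
    {F : (Fin m → ℂ) → ℂ} (hF : DifferentiableOn ℂ F {z | ∀ i, ‖z i‖ < R})
    (hC : ∀ z : Fin m → ℂ, (∀ i, ‖z i‖ < R) → ‖F z‖ ≤ C) :
    ∃ a : (Fin m → ℕ) → ℂ, (∀ α, ‖a α‖ ≤ C * ∏ i, ρ⁻¹ ^ α i) ∧
      ∀ z : Fin m → ℂ, (∀ i, ‖z i‖ < ρ) → HasSum (fun α => a α * ∏ i, z i ^ α i) (F z) := by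
  have hmem : ∀ θ : Fin m → ℝ, ∀ i, ‖torusMap 0 (fun _ => ρ) θ i‖ < R := fun θ i => by
    rwa [norm_torusMap_zero hρ.le]
  have hne : ∀ (θ : Fin m → ℝ) i, torusMap 0 (fun _ => ρ) θ i ≠ 0 := fun θ i =>
    norm_pos_iff.1 ((norm_torusMap_zero hρ.le θ i).symm ▸ hρ)
  have hFc : Continuous fun θ : Fin m → ℝ => F (torusMap 0 (fun _ => ρ) θ) :=
    hF.continuousOn.comp_continuous (continuous_torusMap _ _) hmem
  have hC₀ : 0 ≤ C := (norm_nonneg _).trans (hC 0 fun i => by simpa using hρ.trans hρR)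
  have hpi : (2 * Real.pi * Complex.I : ℂ) ≠ 0 := Complex.two_pi_I_ne_zero
  have hker : ∀ (α : Fin m → ℕ) (θ : Fin m → ℝ),
      ‖(∏ i, (torusMap 0 (fun _ => ρ) θ i)⁻¹ ^ (α i + 1)) * F (torusMap 0 (fun _ => ρ) θ)‖ ≤
        (∏ i, ρ⁻¹ ^ (α i + 1)) * C := by
    intro α θ
    rw [norm_mul, norm_prod]
    simp only [norm_pow, norm_inv, norm_torusMap_zero hρ.le]
    gcongr
    exact hC _ (hmem θ)
  refine ⟨fun α => ((2 * Real.pi * Complex.I) ^ m)⁻¹ *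
    torusIntegral (fun w => (∏ i, (w i)⁻¹ ^ (α i + 1)) * F w) 0 (fun _ => ρ),
    fun α => ?_, fun z hz => ?_⟩
  · rw [norm_mul]
    calc _ ≤ ‖((2 * Real.pi * Complex.I : ℂ) ^ m)⁻¹‖ * (((2 * Real.pi) ^ m * ∏ _i : Fin m, |ρ|) *
          ((∏ i, ρ⁻¹ ^ (α i + 1)) * C)) := by
          gcongr
          exact norm_torusIntegral_le_of_norm_le_const (hker α)
      _ = C * ∏ i, ρ⁻¹ ^ α i := by
          simp only [pow_succ, Finset.prod_mul_distrib, Finset.prod_const, Finset.card_univ,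
            Fintype.card_fin, abs_of_pos hρ, norm_inv, norm_pow, norm_mul, Complex.norm_I,
            Complex.norm_real, Real.norm_eq_abs, abs_of_pos Real.pi_pos, Complex.norm_ofNat]
          have := Real.pi_pos.ne'
          field_simp
          rw [one_div, inv_pow, mul_inv_cancel₀ (pow_ne_zero _ hρ.ne'), one_mul]
  · have hgeo : ∀ i, Summable fun n : ℕ => ‖(‖z i‖ * ρ⁻¹) ^ n‖ := fun i => by
      have h0 : 0 ≤ ‖z i‖ * ρ⁻¹ := by positivity
      have h1 : ‖z i‖ * ρ⁻¹ < 1 := by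
        rw [← div_eq_mul_inv, div_lt_one hρ]
        exact hz i
      simpa [norm_pow, abs_of_nonneg h0] using summable_geometric_of_lt_one h0 h1
    have hbs : Summable fun α : Fin m → ℕ => C * ∏ i, (‖z i‖ * ρ⁻¹) ^ α i :=
      ((summable_and_tsum_pi_prod m (fun i n => (‖z i‖ * ρ⁻¹) ^ n) hgeo).1.of_norm).mul_left C
    have hpt : ∀ θ : Fin m → ℝ, HasSum
        (fun α : Fin m → ℕ => ∏ i, (torusMap 0 (fun _ => ρ) θ i)⁻¹ ^ (α i + 1) * z i ^ α i)
        (∏ i, (torusMap 0 (fun _ => ρ) θ i - z i)⁻¹) := by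
      intro θ
      set w := torusMap 0 (fun _ => ρ) θ
      have hlt : ∀ i, ‖(w i)⁻¹ * z i‖ < 1 := fun i => by
        rw [norm_mul, norm_inv, norm_torusMap_zero hρ.le, inv_mul_lt_one₀ hρ]
        exact hz i
      have hterm : ∀ i (n : ℕ), (w i)⁻¹ ^ (n + 1) * z i ^ n = (w i)⁻¹ * ((w i)⁻¹ * z i) ^ n :=
        fun i n => by rw [mul_pow]; ring
      have hs : ∀ i, Summable fun n : ℕ => ‖(w i)⁻¹ ^ (n + 1) * z i ^ n‖ := fun i => by
        simp only [hterm]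
        exact ((summable_geometric_of_norm_lt_one (hlt i)).mul_left _).norm
      obtain ⟨h1, h2⟩ := summable_and_tsum_pi_prod m
        (fun i n => (w i)⁻¹ ^ (n + 1) * z i ^ n) hs
      have h3 : ∏ i, ∑' n : ℕ, (w i)⁻¹ ^ (n + 1) * z i ^ n = ∏ i, (w i - z i)⁻¹ := by
        refine Finset.prod_congr rfl fun i _ => ?_
        simp only [hterm]
        rw [tsum_mul_left, tsum_geometric_of_norm_lt_one (hlt i), ← mul_inv, mul_sub, mul_one,
          mul_inv_cancel_left₀ (hne θ i)]
      rw [← h3, ← h2]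
      exact h1.of_norm.hasSum
    have hswap : HasSum
        (fun α : Fin m → ℕ => torusIntegral
          (fun w => (∏ i, (w i)⁻¹ ^ (α i + 1) * z i ^ α i) * F w) 0 (fun _ => ρ))
        (torusIntegral (fun w => (∏ i, (w i - z i)⁻¹) * F w) 0 (fun _ => ρ)) := by
      refine MeasureTheory.hasSum_integral_of_dominated_convergence
        (fun α _ => C * ∏ i, (‖z i‖ * ρ⁻¹) ^ α i) (fun α => ?_) (fun α => ?_) ?_ ?_ ?_
      · refine Continuous.aestronglyMeasurable (Continuous.smul
          (f := fun θ : Fin m → ℝ => ∏ i, (ρ : ℂ) * Complex.exp (θ i * Complex.I) * Complex.I)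
          (by fun_prop) (Continuous.mul ?_ hFc))
        refine continuous_finsetProd _ fun i _ => Continuous.mul (Continuous.pow ?_ _)
          continuous_const
        exact (continuous_torusMap_apply _ _ i).inv₀ fun θ => hne θ i
      · refine Filter.Eventually.of_forall fun θ => ?_
        have h := hker α θ
        beta_reduce
        rw [norm_smul, Finset.prod_mul_distrib (f := fun i => (torusMap 0 (fun _ => ρ) θ i)⁻¹ ^ _),
          mul_right_comm _ _ (F _), norm_mul _ (∏ i, z i ^ α i)]
        calc _ ≤ ρ ^ m * (((∏ i, ρ⁻¹ ^ (α i + 1)) * C) * ∏ i, ‖z i‖ ^ α i) := by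
              gcongr
              · simp [norm_prod, abs_of_pos hρ]
              · simp [norm_prod]
          _ = _ := by
              simp only [pow_succ, mul_pow, Finset.prod_mul_distrib, Finset.prod_const,
                Finset.card_univ, Fintype.card_fin]
              field_simp
              rw [one_div, inv_pow, mul_inv_cancel₀ (pow_ne_zero _ hρ.ne'), one_mul]
      · exact Filter.Eventually.of_forall fun _ => hbs
      · exact continuous_const.integrableOn_Icc
      · exact Filter.Eventually.of_forall fun θ => ((hpt θ).mul_right _).const_smul _
    rw [torusIntegral_cauchy_kernel hρ hρR hF hz] at hswap
    have h := hswap.mul_left ((2 * Real.pi * Complex.I : ℂ) ^ m)⁻¹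
    rw [inv_mul_cancel_left₀ (pow_ne_zero _ hpi)] at h
    refine h.congr_fun fun α => ?_
    rw [mul_assoc, mul_comm (torusIntegral _ _ _), ← torusIntegral_const_mul]
    congr 2
    funext w
    rw [Finset.prod_mul_distrib]
    ring


/-- Lemma 3.2, `crucial_lemma`, parts (i) and (iii): composition of a
bounded holomorphic function with functions in the algebra `𝓐`, with norm control. -/
theorem stmt12 (m : ℕ) (hm : 1 ≤ m) (R r : ℝ) (hR : 0 < R) (hr : 0 < r) (hrR : r < R)
    (F : (Fin m → ℂ) → ℂ)
    (hFd : DifferentiableOn ℂ F {z | ∀ i, ‖z i‖ < R})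
    (hFc : ContinuousOn F {z | ∀ i, ‖z i‖ ≤ R})
    (C : ℝ) (hC : ∀ z : Fin m → ℂ, (∀ i, ‖z i‖ ≤ R) → ‖F z‖ ≤ C)
    (f : Fin m → ℂ → ℂ) (cf : Fin m → ℕ → ℕ → ℂ)
    (hsum : ∀ i, Summable (fun kl : ℕ × ℕ => (1 + kl.1 : ℝ) * ‖cf i kl.1 kl.2‖))
    (hlt : ∀ i, (∑' kl : ℕ × ℕ, (1 + kl.1 : ℝ) * ‖cf i kl.1 kl.2‖) < r)
    (hexp : ∀ i, ∀ ζ ∈ ball (0 : ℂ) 1,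
      f i ζ = ∑' kl : ℕ × ℕ, cf i kl.1 kl.2 * ζ ^ kl.1 * (starRingEnd ℂ ζ) ^ kl.2) :
    ∃ h : ℕ → ℕ → ℂ,
      (∀ ζ ∈ ball (0 : ℂ) 1,
        F (fun i => f i ζ) = ∑' kl : ℕ × ℕ, h kl.1 kl.2 * ζ ^ kl.1 * (starRingEnd ℂ ζ) ^ kl.2) ∧
      Summable (fun kl : ℕ × ℕ => (1 + kl.1 : ℝ) * ‖h kl.1 kl.2‖) ∧
      (∑' kl : ℕ × ℕ, (1 + kl.1 : ℝ) * ‖h kl.1 kl.2‖) ≤ (R / (R - r)) ^ m * C := by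
  have hM : ∀ i, HasWeightedExpansion (f i)
      (∑' kl : ℕ × ℕ, (1 + kl.1 : ℝ) * ‖cf i kl.1 kl.2‖) := fun i =>
    ⟨fun p => cf i p.1 p.2, hsum i, le_rfl, hexp i⟩
  obtain ⟨s, hs₀, hsr, hs⟩ : ∃ s, 0 < s ∧ s < r ∧
      ∀ i, (∑' kl : ℕ × ℕ, (1 + kl.1 : ℝ) * ‖cf i kl.1 kl.2‖) ≤ s := by
    have h₁ : ∀ᶠ s in nhdsWithin r (Set.Iio r), ∀ i,
        (∑' kl : ℕ × ℕ, (1 + kl.1 : ℝ) * ‖cf i kl.1 kl.2‖) ≤ s := by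
      refine Filter.eventually_all.2 fun i => ?_
      filter_upwards [Ioo_mem_nhdsLT (hlt i)] with s hs using hs.1.le
    obtain ⟨s, h, hs⟩ := (h₁.and (Ioo_mem_nhdsLT hr)).exists
    exact ⟨s, hs.1, hs.2, h⟩
  set ρ : ℝ := R * (s / r) with hρ_def
  have hρ : 0 < ρ := by positivity
  have hρR : ρ < R := mul_lt_of_lt_one_right hR ((div_lt_one hr).2 hsr)
  have hsρ : s * ρ⁻¹ = r / R := by
    rw [hρ_def]
    field_simp
  have hrR₁ : r / R < 1 := (div_lt_one hR).2 hrR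
  have hsρ' : s < ρ := by
    rw [← div_lt_one hρ, div_eq_mul_inv, hsρ]
    exact hrR₁
  obtain ⟨a, ha, hFa⟩ := exists_hasSum_on_polydisc hρ hρR hFd
    fun z hz => hC z fun i => (hz i).le
  have hC₀ : 0 ≤ C := (norm_nonneg _).trans (hC 0 fun i => by simpa using hR.le)
  have hgeo := summable_and_tsum_pi_prod m (fun _ n => (r / R) ^ n) fun _ => by
    simpa [abs_of_pos hr, abs_of_pos hR] using
      summable_geometric_of_lt_one (div_nonneg hr.le hR.le) hrR₁
  have hKs : Summable fun α : Fin m → ℕ => C * ∏ i, (r / R) ^ α i := hgeo.1.of_norm.mul_left C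
  have hKle : ∀ α : Fin m → ℕ, ‖a α‖ * ∏ i, s ^ α i ≤ C * ∏ i, (r / R) ^ α i := fun α => by
    calc _ ≤ (C * ∏ i, ρ⁻¹ ^ α i) * ∏ i, s ^ α i := by
          gcongr
          exact ha α
      _ = _ := by
          rw [mul_assoc, ← Finset.prod_mul_distrib, ← hsρ]
          simp only [← mul_pow, mul_comm]
  have hK : Summable fun α : Fin m → ℕ => ‖a α‖ * ∏ i, s ^ α i :=
    hKs.of_nonneg_of_le (fun _ => by positivity) hKle
  have hfs : ∀ i, HasWeightedExpansion (f i) s := fun i =>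
    let ⟨h, h₁, h₂, h₃⟩ := hM i
    ⟨h, h₁, h₂.trans (hs i), h₃⟩
  have hmain : HasWeightedExpansion (fun ζ => F fun i => f i ζ) ((R / (R - r)) ^ m * C) := by
    refine HasWeightedExpansion.tsum (U := fun α ζ => a α * ∏ i, f i ζ ^ α i)
      (fun α => (HasWeightedExpansion.const (a α)).mul
        (HasWeightedExpansion.prod Finset.univ fun i => (hfs i).pow (α i))) hK ?_ fun ζ hζ => ?_
    · refine (hK.tsum_le_tsum hKle hKs).trans_eq ?_
      rw [tsum_mul_left, hgeo.2, Finset.prod_const, Finset.card_univ, Fintype.card_fin,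
        tsum_geometric_of_lt_one (div_nonneg hr.le hR.le) hrR₁, mul_comm, one_sub_div hR.ne',
        inv_div]
    · refine (hFa _ fun i => ?_).tsum_eq.symm
      exact ((hfs i).norm_le hζ).trans_lt hsρ'
  obtain ⟨h, h₁, h₂, h₃⟩ := hmain
  exact ⟨fun k l => h (k, l), h₃, h₁, h₂⟩
end

section
/- Let R > 0 and r ∈ (0,R). Let F : ℂ² → ℂ be holomorphic on the open polydisc {(z,w) ∈ ℂ² : |z| < R, |w| < R} and continuous and bounded on its closure, with ‖F‖_∞ the supremum of |F| over the closed polydisc. For functions u : 𝔻 → ℂ admitting an expansion u(ζ) = ∑_{k,l} u_{k,l} ζ^k ζ̄^l, write ‖u‖_* = ∑_{k,l} (1+k)|u_{k,l}|. Then for all f, g, f̃, g̃ : 𝔻 → ℂ admitting such expansions with ‖f‖_*, ‖g‖_*, ‖f̃‖_*, ‖g̃‖_* < r, the compositions F(f,g) and F(f̃,g̃) admit such expansions and ‖F(f,g) − F(f̃,g̃)‖_* ≤ (R²/(R−r)³)·‖F‖_∞·(‖f − f̃‖_* + ‖g − g̃‖_*). -/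
open Metric

/-- The weighted coefficient norm `‖u‖_* = ∑ (1+k)|u_{k,l}|` is finite, with expansion
`u(ζ) = ∑ u_{k,l} ζ^k ζ̄^l` on the unit disc. -/
def HasStarExp (u : ℂ → ℂ) (cu : ℕ → ℕ → ℂ) : Prop :=
  (∀ ζ ∈ ball (0 : ℂ) 1,
    u ζ = ∑' kl : ℕ × ℕ, cu kl.1 kl.2 * ζ ^ kl.1 * (starRingEnd ℂ ζ) ^ kl.2) ∧
  Summable (fun kl : ℕ × ℕ => (1 + kl.1 : ℝ) * ‖cu kl.1 kl.2‖)

theorem norm_coeff_cauchyPowerSeries_le {f : ℂ → ℂ} {ρ C : ℝ} (hρ : 0 < ρ)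
    (hf : ∀ z, ‖z‖ = ρ → ‖f z‖ ≤ C) (n : ℕ) :
    ‖(cauchyPowerSeries f 0 ρ).coeff n‖ ≤ C * ρ⁻¹ ^ n := by
  have hmean : ‖∫ θ in (0 : ℝ)..2 * Real.pi, ‖f (circleMap 0 ρ θ)‖‖ ≤ C * |2 * Real.pi - 0| :=
    intervalIntegral.norm_integral_le_of_norm_le_const fun θ _ => by
      simpa using hf (circleMap 0 ρ θ) (by simp [abs_of_pos hρ])
  have hpi := Real.two_pi_pos
  rw [sub_zero, abs_of_pos hpi] at hmean
  rw [← FormalMultilinearSeries.norm_apply_eq_norm_coef]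
  refine (norm_cauchyPowerSeries_le f 0 ρ n).trans ?_
  rw [abs_of_pos hρ]
  gcongr
  rw [inv_mul_le_iff₀ hpi, mul_comm _ C]
  exact (le_abs_self _).trans hmean

theorem hasSum_coeff_cauchyPowerSeries {f : ℂ → ℂ} {ρ : ℝ} {w : ℂ}
    (hf : CircleIntegrable f 0 ρ) (hw : ‖w‖ < ρ) :
    HasSum (fun n => (cauchyPowerSeries f 0 ρ).coeff n * w ^ n)
      ((2 * Real.pi * Complex.I : ℂ)⁻¹ • ∮ z in C(0, ρ), (z - w)⁻¹ • f z) := by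
  simpa [FormalMultilinearSeries.apply_eq_pow_smul_coeff, mul_comm]
    using hasSum_cauchyPowerSeries_integral hf hw

theorem cauchy_integral_eq {f : ℂ → ℂ} {R ρ : ℝ} (hρR : ρ < R)
    (hf : DifferentiableOn ℂ f (ball 0 R)) {w : ℂ} (hw : ‖w‖ < ρ) :
    ((2 * Real.pi * Complex.I : ℂ)⁻¹ • ∮ z in C(0, ρ), (z - w)⁻¹ • f z) = f w :=
  Complex.two_pi_I_inv_smul_circleIntegral_sub_inv_smul_of_differentiable_on_off_countable
    Set.countable_empty (by simpa using hw)
    (hf.continuousOn.mono (closedBall_subset_ball hρR))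
    fun x hx => hf.differentiableAt (isOpen_ball.mem_nhds (ball_subset_ball hρR.le hx.1))

theorem exists_doublePowerSeries_of_lt {F : ℂ × ℂ → ℂ} {R ρ C : ℝ} (hρ : 0 < ρ) (hρR : ρ < R)
    (hFd : DifferentiableOn ℂ F {zw | ‖zw.1‖ < R ∧ ‖zw.2‖ < R})
    (hC : ∀ zw : ℂ × ℂ, ‖zw.1‖ < R → ‖zw.2‖ < R → ‖F zw‖ ≤ C) :
    ∃ a : ℕ × ℕ → ℂ, (∀ p, ‖a p‖ ≤ C * ρ⁻¹ ^ (p.1 + p.2)) ∧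
      ∀ z w : ℂ, ‖z‖ < ρ → ‖w‖ < ρ → F (z, w) = ∑' p : ℕ × ℕ, a p * (z ^ p.1 * w ^ p.2) := by
  have hC0 : 0 ≤ C := (norm_nonneg _).trans (hC 0 (by simp; linarith) (by simp; linarith))
  have hcont : Continuous fun x : ℝ × ℝ => F (circleMap 0 ρ x.2, circleMap 0 ρ x.1) :=
    hFd.continuousOn.comp_continuous (by fun_prop) fun x => by
      simp [abs_of_pos hρ, hρR]
  have hslice₁ : ∀ t : ℂ, ‖t‖ < R → DifferentiableOn ℂ (fun s => F (s, t)) (ball 0 R) := by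
    intro t ht
    exact hFd.comp (by fun_prop) fun s hs => ⟨by simpa using hs, ht⟩
  have hslice₂ : ∀ s : ℂ, ‖s‖ < R → DifferentiableOn ℂ (fun t => F (s, t)) (ball 0 R) := by
    intro s hs
    exact hFd.comp (by fun_prop) fun t ht => ⟨hs, by simpa using ht⟩
  let b : ℕ → ℂ → ℂ := fun m t => (cauchyPowerSeries (fun s => F (s, t)) 0 ρ).coeff m
  have hbC : ∀ m t, ‖t‖ = ρ → ‖b m t‖ ≤ C * ρ⁻¹ ^ m := fun m t ht =>
    norm_coeff_cauchyPowerSeries_le hρ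
      (fun s hs => hC (s, t) (by simpa [hs] using hρR) (by simpa [ht] using hρR)) m
  have hcircle : ∀ θ, circleMap 0 ρ θ ≠ 0 := fun θ => circleMap_ne_center hρ.ne'
  have hbcont : ∀ m, Continuous fun θ : ℝ => b m (circleMap 0 ρ θ) := by
    intro m
    have : (fun θ : ℝ => b m (circleMap 0 ρ θ)) = fun θ : ℝ =>
        (2 * Real.pi * Complex.I : ℂ)⁻¹ • ∫ φ in (0 : ℝ)..2 * Real.pi,
          deriv (circleMap 0 ρ) φ • ((1 / (circleMap 0 ρ φ - 0)) ^ m • (circleMap 0 ρ φ - 0)⁻¹ •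
            F (circleMap 0 ρ φ, circleMap 0 ρ θ)) := by
      funext θ
      exact cauchyPowerSeries_apply (fun s => F (s, circleMap 0 ρ θ)) 0 ρ m 1
    rw [this]
    rw [continuous_const_smul_iff₀ (by simp [Real.pi_ne_zero])]
    apply intervalIntegral.continuous_parametric_intervalIntegral_of_continuous'
    simp only [Function.uncurry_def, deriv_circleMap, sub_zero, one_div]
    have hinv : Continuous fun x : ℝ × ℝ => (circleMap 0 ρ x.2)⁻¹ :=
      Continuous.inv₀ (by fun_prop) fun x => hcircle x.2
    have hc2 : Continuous fun x : ℝ × ℝ => circleMap 0 ρ x.2 := by fun_prop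
    exact (hc2.mul continuous_const).smul ((hinv.pow m).smul (hinv.smul hcont))
  have hbint : ∀ m, CircleIntegrable (b m) 0 ρ := fun m =>
    (hbcont m).intervalIntegrable (μ := MeasureTheory.volume) 0 (2 * Real.pi)
  let a : ℕ × ℕ → ℂ := fun p => (cauchyPowerSeries (b p.1) 0 ρ).coeff p.2
  have ha : ∀ p, ‖a p‖ ≤ C * ρ⁻¹ ^ (p.1 + p.2) := fun p => by
    simpa [pow_add, mul_assoc] using norm_coeff_cauchyPowerSeries_le hρ (hbC p.1) p.2
  refine ⟨a, ha, fun z w hz hw => ?_⟩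
  have hgeo : ∀ x : ℂ, ‖x‖ < ρ → Summable fun m : ℕ => (ρ⁻¹ * ‖x‖) ^ m := fun x hx =>
    summable_geometric_of_lt_one (by positivity) (by rwa [inv_mul_lt_iff₀ hρ, mul_one])
  have hsum : Summable fun p : ℕ × ℕ => a p * (z ^ p.1 * w ^ p.2) := by
    have := ((hgeo z hz).mul_of_nonneg (hgeo w hw) (fun _ => by positivity)
      (fun _ => by positivity)).mul_left C
    refine .of_norm_bounded this fun p => ?_
    rw [norm_mul, norm_mul, norm_pow, norm_pow]
    calc _ ≤ C * ρ⁻¹ ^ (p.1 + p.2) * (‖z‖ ^ p.1 * ‖w‖ ^ p.2) := by gcongr; exact ha p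
      _ = _ := by simp only [mul_pow, pow_add]; ring
  rw [hsum.tsum_prod]
  have hinner : ∀ m, ∑' n, a (m, n) * (z ^ m * w ^ n) =
      (2 * Real.pi * Complex.I : ℂ)⁻¹ • ∮ t in C(0, ρ), (t - w)⁻¹ • (b m t * z ^ m) := by
    intro m
    have h := (hasSum_coeff_cauchyPowerSeries (hbint m) hw).mul_left (z ^ m)
    have h2 : ∮ t in C(0, ρ), (t - w)⁻¹ • (b m t * z ^ m) =
        z ^ m * ∮ t in C(0, ρ), (t - w)⁻¹ • b m t := by
      rw [← smul_eq_mul (z ^ m), ← circleIntegral.integral_smul]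
      congr 1; funext t; simp only [smul_eq_mul]; ring
    rw [h2, ← smul_eq_mul (z ^ m), smul_comm, smul_eq_mul (z ^ m), ← h.tsum_eq]
    exact tsum_congr fun n => by simp only [a]; ring
  simp only [hinner]
  rw [← cauchy_integral_eq hρR (hslice₂ z (hz.trans hρR)) hw]
  refine (HasSum.tsum_eq (HasSum.const_smul _ ?_)).symm
  have hne : ∀ θ, circleMap 0 ρ θ - w ≠ 0 := fun θ h => by
    rw [sub_eq_zero] at h
    rw [← h] at hw
    simp [abs_of_pos hρ] at hw
  have hk : Continuous fun θ : ℝ => deriv (circleMap 0 ρ) θ * (circleMap 0 ρ θ - w)⁻¹ := by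
    simp only [deriv_circleMap]
    exact ((continuous_circleMap 0 ρ).mul continuous_const).mul
      (Continuous.inv₀ (by fun_prop) hne)
  refine intervalIntegral.hasSum_integral_of_dominated_convergence
    (fun m θ => ‖deriv (circleMap 0 ρ) θ * (circleMap 0 ρ θ - w)⁻¹‖ * (C * (ρ⁻¹ * ‖z‖) ^ m))
    (fun m => ?_) (fun m => .of_forall fun θ _ => ?_) (.of_forall fun θ _ => ?_) ?_
    (.of_forall fun θ _ => ?_)
  · refine Continuous.aestronglyMeasurable ?_
    simp only [smul_eq_mul, ← mul_assoc]
    exact (hk.mul (hbcont m)).mul continuous_const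
  · dsimp only
    rw [smul_eq_mul, smul_eq_mul, ← mul_assoc, norm_mul, norm_mul (b m _), norm_pow, mul_pow,
      ← mul_assoc C]
    gcongr
    exact hbC m _ (by simp [abs_of_pos hρ])
  · exact ((hgeo z hz).mul_left C).mul_left _
  · simp only [tsum_mul_left]
    exact (hk.norm.mul continuous_const).intervalIntegrable _ _
  · refine HasSum.const_smul _ (HasSum.const_smul _ ?_)
    have hd := hslice₁ (circleMap 0 ρ θ) (by simpa [abs_of_pos hρ] using hρR)
    have := hasSum_coeff_cauchyPowerSeries (w := z) (f := fun s => F (s, circleMap 0 ρ θ))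
      (ρ := ρ) ((hd.continuousOn.mono ?_).circleIntegrable hρ.le) hz
    · rwa [cauchy_integral_eq hρR hd hz] at this
    · exact (sphere_subset_closedBall.trans (closedBall_subset_ball hρR))

open Filter Topology in
theorem exists_doublePowerSeries {F : ℂ × ℂ → ℂ} {R C : ℝ} (hR : 0 < R)
    (hFd : DifferentiableOn ℂ F {zw | ‖zw.1‖ < R ∧ ‖zw.2‖ < R})
    (hC : ∀ zw : ℂ × ℂ, ‖zw.1‖ < R → ‖zw.2‖ < R → ‖F zw‖ ≤ C) :
    ∃ a : ℕ × ℕ → ℂ, (∀ p, ‖a p‖ ≤ C * R⁻¹ ^ (p.1 + p.2)) ∧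
      ∀ z w : ℂ, ‖z‖ < R → ‖w‖ < R → F (z, w) = ∑' p : ℕ × ℕ, a p * (z ^ p.1 * w ^ p.2) := by
  have hC0 : 0 ≤ C := (norm_nonneg _).trans (hC 0 (by simpa) (by simpa))
  have hex : ∀ ρ : ℝ, ∃ a : ℕ × ℕ → ℂ, 0 < ρ → ρ < R →
      (∀ p, ‖a p‖ ≤ C * ρ⁻¹ ^ (p.1 + p.2)) ∧
      ∀ z w : ℂ, ‖z‖ < ρ → ‖w‖ < ρ → F (z, w) = ∑' p : ℕ × ℕ, a p * (z ^ p.1 * w ^ p.2) := by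
    intro ρ
    by_cases h : 0 < ρ ∧ ρ < R
    · obtain ⟨a, ha⟩ := exists_doublePowerSeries_of_lt h.1 h.2 hFd hC
      exact ⟨a, fun _ _ => ha⟩
    · exact ⟨0, fun h₁ h₂ => (h ⟨h₁, h₂⟩).elim⟩
  choose a ha using hex
  let 𝒰 : Ultrafilter ℝ := Ultrafilter.of (𝓝[<] R)
  have h𝒰 : (𝒰 : Filter ℝ) ≤ 𝓝[<] R := Ultrafilter.of_le _
  have hev : ∀ ρ₀ < R, ∀ᶠ ρ in (𝒰 : Filter ℝ), ρ₀ < ρ ∧ ρ < R := fun ρ₀ h₀ =>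
    h𝒰 (Ioo_mem_nhdsLT h₀)
  have hlim : ∀ p, ∃ α : ℂ, Tendsto (fun ρ => a ρ p) 𝒰 (𝓝 α) := by
    intro p
    have hmem : ∀ᶠ ρ in (𝒰 : Filter ℝ), a ρ p ∈
        closedBall (0 : ℂ) (C * (R / 2)⁻¹ ^ (p.1 + p.2)) := by
      filter_upwards [hev (R / 2) (by linarith)] with ρ hρ
      have h0 : 0 < ρ := by linarith [hρ.1]
      rw [mem_closedBall_zero_iff]
      refine ((ha ρ h0 hρ.2).1 p).trans ?_
      gcongr
      exact hρ.1.le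
    obtain ⟨α, -, hα⟩ := (isCompact_closedBall (0 : ℂ) _).ultrafilter_le_nhds
      (𝒰.map fun ρ => a ρ p) (le_principal_iff.2 hmem)
    exact ⟨α, hα⟩
  choose α hα using hlim
  refine ⟨α, fun p => ?_, fun z w hz hw => ?_⟩
  · have hid : Tendsto (fun ρ : ℝ => ρ) 𝒰 (𝓝 R) := h𝒰.trans nhdsWithin_le_nhds
    refine le_of_tendsto_of_tendsto (hα p).norm (((hid.inv₀ hR.ne').pow _).const_mul C) ?_
    filter_upwards [hev 0 hR] with ρ hρ using (ha ρ hρ.1 hρ.2).1 p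
  · obtain ⟨ρ₀, h₀, h₀R⟩ := exists_between (max_lt hz hw)
    have hz₀ : ‖z‖ < ρ₀ := (le_max_left _ _).trans_lt h₀
    have hw₀ : ‖w‖ < ρ₀ := (le_max_right _ _).trans_lt h₀
    have hρ₀ : 0 < ρ₀ := (norm_nonneg z).trans_lt hz₀
    have hgeo : ∀ x : ℂ, ‖x‖ < ρ₀ → Summable fun m : ℕ => (ρ₀⁻¹ * ‖x‖) ^ m := fun x hx =>
      summable_geometric_of_lt_one (by positivity) (by rwa [inv_mul_lt_iff₀ hρ₀, mul_one])
    have hbound := ((hgeo z hz₀).mul_of_nonneg (hgeo w hw₀) (fun _ => by positivity)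
      (fun _ => by positivity)).mul_left C
    refine tendsto_nhds_unique (f := fun ρ => ∑' p : ℕ × ℕ, a ρ p * (z ^ p.1 * w ^ p.2))
      (l := (𝒰 : Filter ℝ)) ?_
      (tendsto_tsum_of_dominated_convergence hbound (fun p => (hα p).mul_const _) ?_)
    · refine tendsto_const_nhds.congr' ?_
      filter_upwards [hev ρ₀ h₀R] with ρ hρ
      exact (ha ρ (hρ₀.trans hρ.1) hρ.2).2 z w (hz₀.trans hρ.1) (hw₀.trans hρ.1)
    · filter_upwards [hev ρ₀ h₀R] with ρ hρ p
      have h0 : 0 < ρ := hρ₀.trans hρ.1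
      rw [norm_mul, norm_mul, norm_pow, norm_pow]
      calc _ ≤ C * ρ₀⁻¹ ^ (p.1 + p.2) * (‖z‖ ^ p.1 * ‖w‖ ^ p.2) := by
            gcongr
            refine ((ha ρ h0 hρ.2).1 p).trans ?_
            gcongr
            exact hρ.1.le
        _ = _ := by simp only [mul_pow, pow_add]; ring

namespace MvPowerSeries

open scoped ENNReal

variable {σ : Type*} {w : (σ →₀ ℕ) → ℝ≥0∞}

/-- The weighted `ℓ¹` norm of the coefficients of a power series. -/
noncomputable def weightedNorm (w : (σ →₀ ℕ) → ℝ≥0∞) (u : MvPowerSeries σ ℂ) : ℝ≥0∞ :=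
  ∑' k, w k * ‖coeff k u‖ₑ

/-- The value of a power series when the monomials are assigned the values `χ`. -/
noncomputable def evalMonomials (χ : (σ →₀ ℕ) → ℂ) (u : MvPowerSeries σ ℂ) : ℂ :=
  ∑' k, coeff k u * χ k

/-- The coefficientwise sum `∑ c p * U p`. -/
noncomputable def tsumSMul {ι : Type*} (c : ι → ℂ) (U : ι → MvPowerSeries σ ℂ) :
    MvPowerSeries σ ℂ :=
  fun k => ∑' p, c p * coeff k (U p)

theorem coeff_tsumSMul {ι : Type*} (c : ι → ℂ) (U : ι → MvPowerSeries σ ℂ) (k : σ →₀ ℕ) :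
    coeff k (tsumSMul c U) = ∑' p, c p * coeff k (U p) := rfl

theorem weightedNorm_add_le (u v : MvPowerSeries σ ℂ) :
    weightedNorm w (u + v) ≤ weightedNorm w u + weightedNorm w v := by
  unfold weightedNorm
  rw [← ENNReal.tsum_add]
  refine ENNReal.tsum_le_tsum fun k => ?_
  rw [← mul_add, map_add]
  gcongr
  exact enorm_add_le _ _

theorem weightedNorm_sub_le (u v : MvPowerSeries σ ℂ) :
    weightedNorm w (u - v) ≤ weightedNorm w u + weightedNorm w v := by
  refine (sub_eq_add_neg u v ▸ weightedNorm_add_le u (-v)).trans_eq ?_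
  simp [weightedNorm]

theorem weightedNorm_one (hw : w 0 = 1) : weightedNorm w 1 = 1 := by
  classical
  rw [weightedNorm, tsum_eq_single 0]
  · simp [hw]
  · intro k hk
    simp [coeff_one, hk]

theorem weightedNorm_mul_le (hw : ∀ k l, w (k + l) ≤ w k * w l) (u v : MvPowerSeries σ ℂ) :
    weightedNorm w (u * v) ≤ weightedNorm w u * weightedNorm w v := by
  classical
  calc weightedNorm w (u * v)
    _ ≤ ∑' k, ∑' p : Finset.HasAntidiagonal.antidiagonal k,
          (w p.1.1 * ‖coeff p.1.1 u‖ₑ) * (w p.1.2 * ‖coeff p.1.2 v‖ₑ) := by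
        refine ENNReal.tsum_le_tsum fun k => ?_
        rw [tsum_fintype, Finset.sum_coe_sort (Finset.HasAntidiagonal.antidiagonal k)
          (fun p => (w p.1 * ‖coeff p.1 u‖ₑ) * (w p.2 * ‖coeff p.2 v‖ₑ)), coeff_mul]
        refine (mul_le_mul_right (enorm_sum_le _ _) _).trans ?_
        rw [Finset.mul_sum]
        refine Finset.sum_le_sum fun p hp => ?_
        rw [← Finset.HasAntidiagonal.mem_antidiagonal.1 hp, enorm_mul, mul_mul_mul_comm]
        gcongr
        exact hw _ _
    _ = ∑' p : (σ →₀ ℕ) × (σ →₀ ℕ), (w p.1 * ‖coeff p.1 u‖ₑ) * (w p.2 * ‖coeff p.2 v‖ₑ) := by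
        rw [← Finset.HasAntidiagonal.sigmaAntidiagonalEquivProd.tsum_eq, ENNReal.tsum_sigma']
        rfl
    _ = weightedNorm w u * weightedNorm w v := by
        rw [ENNReal.tsum_prod (f := fun k l => (w k * ‖coeff k u‖ₑ) * (w l * ‖coeff l v‖ₑ))]
        simp only [ENNReal.tsum_mul_left, ENNReal.tsum_mul_right, weightedNorm]

theorem weightedNorm_pow_le (hw₀ : w 0 = 1) (hw : ∀ k l, w (k + l) ≤ w k * w l)
    {u : MvPowerSeries σ ℂ} {r : ℝ≥0∞} (hu : weightedNorm w u ≤ r) (n : ℕ) :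
    weightedNorm w (u ^ n) ≤ r ^ n := by
  induction n with
  | zero => simp [weightedNorm_one hw₀]
  | succ n ih =>
    rw [pow_succ, pow_succ]
    exact (weightedNorm_mul_le hw _ _).trans (mul_le_mul' ih hu)

theorem weightedNorm_pow_sub_pow_le (hw₀ : w 0 = 1) (hw : ∀ k l, w (k + l) ≤ w k * w l)
    {u v : MvPowerSeries σ ℂ} {r : ℝ≥0∞} (hu : weightedNorm w u ≤ r) (hv : weightedNorm w v ≤ r)
    (n : ℕ) :
    weightedNorm w (u ^ n - v ^ n) ≤ n * r ^ (n - 1) * weightedNorm w (u - v) := by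
  induction n with
  | zero => simp [weightedNorm]
  | succ n ih =>
    have hsplit : u ^ (n + 1) - v ^ (n + 1) = u ^ n * (u - v) + (u ^ n - v ^ n) * v := by ring
    rw [hsplit]
    refine (weightedNorm_add_le _ _).trans ((add_le_add (weightedNorm_mul_le hw _ _)
      (weightedNorm_mul_le hw _ _)).trans ((add_le_add
        (mul_le_mul' (weightedNorm_pow_le hw₀ hw hu n) le_rfl) (mul_le_mul' ih hv)).trans_eq ?_))
    cases n with
    | zero => simp
    | succ n => simp only [Nat.add_sub_cancel, pow_succ]; push_cast; ring

theorem weightedNorm_monomial_sub_le (hw₀ : w 0 = 1) (hw : ∀ k l, w (k + l) ≤ w k * w l)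
    {u v u' v' : MvPowerSeries σ ℂ} {r : ℝ≥0∞}
    (hu : weightedNorm w u ≤ r) (hv : weightedNorm w v ≤ r)
    (hu' : weightedNorm w u' ≤ r) (hv' : weightedNorm w v' ≤ r) (m n : ℕ) :
    weightedNorm w (u ^ m * v ^ n - u' ^ m * v' ^ n) ≤
      m * r ^ (m - 1) * r ^ n * weightedNorm w (u - u') +
        r ^ m * (n * r ^ (n - 1)) * weightedNorm w (v - v') := by
  have hsplit : u ^ m * v ^ n - u' ^ m * v' ^ n =
      (u ^ m - u' ^ m) * v ^ n + u' ^ m * (v ^ n - v' ^ n) := by ring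
  rw [hsplit]
  refine (weightedNorm_add_le _ _).trans ((add_le_add (weightedNorm_mul_le hw _ _)
    (weightedNorm_mul_le hw _ _)).trans ((add_le_add
      (mul_le_mul' (weightedNorm_pow_sub_pow_le hw₀ hw hu hu' m) (weightedNorm_pow_le hw₀ hw hv n))
      (mul_le_mul' (weightedNorm_pow_le hw₀ hw hu' m)
        (weightedNorm_pow_sub_pow_le hw₀ hw hv hv' n))).trans_eq ?_))
  ring

theorem enorm_coeff_le_weightedNorm (hw : ∀ k, 1 ≤ w k) (u : MvPowerSeries σ ℂ) (k : σ →₀ ℕ) :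
    ‖coeff k u‖ₑ ≤ weightedNorm w u :=
  (le_mul_of_one_le_left' (hw k)).trans (ENNReal.le_tsum (f := fun k => w k * ‖coeff k u‖ₑ) k)

theorem summable_of_tsum_enorm_ne_top {ι : Type*} {f : ι → ℂ} (hf : ∑' i, ‖f i‖ₑ ≠ ∞) :
    Summable f := by
  refine .of_norm ?_
  simpa using ENNReal.summable_toReal hf

section Eval

variable {χ : (σ →₀ ℕ) → ℂ}

theorem tsum_enorm_coeff_mul_le (hw : ∀ k, 1 ≤ w k) (hχ : ∀ k, ‖χ k‖ ≤ 1)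
    (u : MvPowerSeries σ ℂ) :
    ∑' k, ‖coeff k u * χ k‖ₑ ≤ weightedNorm w u := by
  refine ENNReal.tsum_le_tsum fun k => ?_
  rw [enorm_mul, mul_comm]
  gcongr
  refine le_trans ?_ (hw k)
  rw [← ofReal_norm]
  exact ENNReal.ofReal_le_one.2 (hχ _)

theorem enorm_evalMonomials_le (hw : ∀ k, 1 ≤ w k) (hχ : ∀ k, ‖χ k‖ ≤ 1)
    (u : MvPowerSeries σ ℂ) : ‖evalMonomials χ u‖ₑ ≤ weightedNorm w u :=
  enorm_tsum_le_tsum_enorm.trans (tsum_enorm_coeff_mul_le hw hχ u)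

theorem summable_norm_coeff_mul (hw : ∀ k, 1 ≤ w k) (hχ : ∀ k, ‖χ k‖ ≤ 1)
    {u : MvPowerSeries σ ℂ} (hu : weightedNorm w u ≠ ∞) :
    Summable fun k => ‖coeff k u * χ k‖ :=
  (summable_of_tsum_enorm_ne_top
    (ne_top_of_le_ne_top hu (tsum_enorm_coeff_mul_le hw hχ u))).norm

theorem evalMonomials_one (hχ₀ : χ 0 = 1) : evalMonomials χ 1 = 1 := by
  classical
  rw [evalMonomials, tsum_eq_single 0]
  · simp [hχ₀]
  · intro k hk
    simp [coeff_one, hk]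

theorem evalMonomials_mul (hw : ∀ k, 1 ≤ w k) (hχ : ∀ k, ‖χ k‖ ≤ 1)
    (hχm : ∀ k l, χ (k + l) = χ k * χ l)
    {u v : MvPowerSeries σ ℂ} (hu : weightedNorm w u ≠ ∞) (hv : weightedNorm w v ≠ ∞) :
    evalMonomials χ (u * v) = evalMonomials χ u * evalMonomials χ v := by
  classical
  have hu' := summable_norm_coeff_mul hw hχ hu
  have hv' := summable_norm_coeff_mul hw hχ hv
  calc evalMonomials χ (u * v)
    _ = ∑' k, ∑ p ∈ Finset.HasAntidiagonal.antidiagonal k,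
          (coeff p.1 u * χ p.1) * (coeff p.2 v * χ p.2) := by
        refine tsum_congr fun k => ?_
        rw [coeff_mul, Finset.sum_mul]
        refine Finset.sum_congr rfl fun p hp => ?_
        rw [← Finset.HasAntidiagonal.mem_antidiagonal.1 hp, hχm]
        ring
    _ = evalMonomials χ u * evalMonomials χ v :=
        (hu'.of_norm.tsum_mul_tsum_eq_tsum_sum_antidiagonal hv'.of_norm
          (summable_mul_of_summable_norm (f := fun k => coeff k u * χ k)
            (g := fun k => coeff k v * χ k) hu' hv')).symm

theorem evalMonomials_pow (hw : ∀ k, 1 ≤ w k) (hw₀ : w 0 = 1)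
    (hwm : ∀ k l, w (k + l) ≤ w k * w l) (hχ : ∀ k, ‖χ k‖ ≤ 1)
    (hχ₀ : χ 0 = 1) (hχm : ∀ k l, χ (k + l) = χ k * χ l)
    {u : MvPowerSeries σ ℂ} (hu : weightedNorm w u ≠ ∞) (n : ℕ) :
    evalMonomials χ (u ^ n) = evalMonomials χ u ^ n := by
  induction n with
  | zero => simp [evalMonomials_one hχ₀]
  | succ n ih =>
    rw [pow_succ, pow_succ, evalMonomials_mul hw hχ hχm _ hu, ih]
    exact ne_top_of_le_ne_top (ENNReal.pow_ne_top hu) (weightedNorm_pow_le hw₀ hwm le_rfl n)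

end Eval

section TsumSMul

variable {ι : Type*} {c : ι → ℂ} {U V : ι → MvPowerSeries σ ℂ}

theorem weightedNorm_tsumSMul_le :
    weightedNorm w (tsumSMul c U) ≤ ∑' p, ‖c p‖ₑ * weightedNorm w (U p) := by
  calc weightedNorm w (tsumSMul c U)
    _ ≤ ∑' k, ∑' p, ‖c p‖ₑ * (w k * ‖coeff k (U p)‖ₑ) := by
        refine ENNReal.tsum_le_tsum fun k => ?_
        rw [coeff_tsumSMul]
        refine (mul_le_mul_right enorm_tsum_le_tsum_enorm _).trans_eq ?_
        rw [← ENNReal.tsum_mul_left]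
        exact tsum_congr fun p => by rw [enorm_mul, mul_left_comm]
    _ = _ := by
        rw [ENNReal.tsum_comm]
        simp only [ENNReal.tsum_mul_left, weightedNorm]

theorem summable_mul_coeff (hw : ∀ k, 1 ≤ w k)
    (hU : ∑' p, ‖c p‖ₑ * weightedNorm w (U p) ≠ ∞) (k : σ →₀ ℕ) :
    Summable fun p => c p * coeff k (U p) := by
  refine summable_of_tsum_enorm_ne_top (ne_top_of_le_ne_top hU (ENNReal.tsum_le_tsum fun p => ?_))
  rw [enorm_mul]
  gcongr
  exact enorm_coeff_le_weightedNorm hw _ _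

theorem tsumSMul_sub (hw : ∀ k, 1 ≤ w k)
    (hU : ∑' p, ‖c p‖ₑ * weightedNorm w (U p) ≠ ∞)
    (hV : ∑' p, ‖c p‖ₑ * weightedNorm w (V p) ≠ ∞) :
    tsumSMul c U - tsumSMul c V = tsumSMul c (fun p => U p - V p) := by
  ext k
  rw [map_sub, coeff_tsumSMul, coeff_tsumSMul, coeff_tsumSMul,
    ← (summable_mul_coeff hw hU k).tsum_sub (summable_mul_coeff hw hV k)]
  simp only [map_sub, mul_sub]

theorem evalMonomials_tsumSMul {χ : (σ →₀ ℕ) → ℂ} (hw : ∀ k, 1 ≤ w k)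
    (hχ : ∀ k, ‖χ k‖ ≤ 1) (hU : ∑' p, ‖c p‖ₑ * weightedNorm w (U p) ≠ ∞) :
    evalMonomials χ (tsumSMul c U) = ∑' p, c p * evalMonomials χ (U p) := by
  simp only [evalMonomials, coeff_tsumSMul, ← tsum_mul_left, ← tsum_mul_right]
  have hs : Summable (Function.uncurry fun p k => c p * (coeff k (U p) * χ k)) := by
    refine summable_of_tsum_enorm_ne_top (ne_top_of_le_ne_top hU ?_)
    refine (ENNReal.tsum_prod (f := fun p k => ‖c p * (coeff k (U p) * χ k)‖ₑ)).trans_le ?_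
    refine ENNReal.tsum_le_tsum fun p => ?_
    simp only [enorm_mul (c p), ENNReal.tsum_mul_left]
    gcongr
    exact tsum_enorm_coeff_mul_le hw hχ _
  rw [← hs.tsum_comm]
  simp only [mul_assoc]

end TsumSMul

end MvPowerSeries

theorem ENNReal.tsum_mul_tsum_prod {ι κ : Type*} (f : ι → ENNReal) (g : κ → ENNReal) :
    ∑' p : ι × κ, f p.1 * g p.2 = (∑' i, f i) * ∑' j, g j := by
  rw [ENNReal.tsum_prod (f := fun i j => f i * g j)]
  simp only [ENNReal.tsum_mul_left, ENNReal.tsum_mul_right]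

theorem ENNReal.tsum_ofReal_inv_pow_mul {r R : ℝ} (hr : 0 < r) (hrR : r < R) :
    ∑' n : ℕ, ENNReal.ofReal R⁻¹ ^ n * ENNReal.ofReal r ^ n = ENNReal.ofReal (R / (R - r)) := by
  have hR : 0 < R := hr.trans hrR
  have hs := hasSum_geometric_of_lt_one (r := r / R) (by positivity) ((div_lt_one hR).2 hrR)
  have hval : R / (R - r) = (1 - r / R)⁻¹ := by
    have : R - r ≠ 0 := by linarith
    field_simp
  rw [hval, ← hs.tsum_eq, ENNReal.ofReal_tsum_of_nonneg (fun n => by positivity) hs.summable]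
  refine tsum_congr fun n => ?_
  rw [← mul_pow, ← ENNReal.ofReal_mul (by positivity), ← ENNReal.ofReal_pow (by positivity),
    div_eq_inv_mul]

theorem ENNReal.tsum_ofReal_inv_pow_mul_deriv {r R : ℝ} (hr : 0 < r) (hrR : r < R) :
    ∑' n : ℕ, ENNReal.ofReal R⁻¹ ^ n * (n * ENNReal.ofReal r ^ (n - 1)) =
      ENNReal.ofReal (R / (R - r) ^ 2) := by
  have hR : 0 < R := hr.trans hrR
  have hx : ‖r / R‖ < 1 := by
    rw [Real.norm_of_nonneg (by positivity)]
    exact (div_lt_one hR).2 hrR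
  have hs := (hasSum_coe_mul_geometric_of_norm_lt_one hx).div_const r
  have hval : R / (R - r) ^ 2 = r / R / (1 - r / R) ^ 2 / r := by
    have : R - r ≠ 0 := by linarith
    field_simp
  rw [hval, ← hs.tsum_eq, ENNReal.ofReal_tsum_of_nonneg (fun n => by positivity) hs.summable]
  refine tsum_congr fun n => ?_
  rw [← ENNReal.ofReal_pow hr.le, ← ENNReal.ofReal_pow (by positivity), ← ENNReal.ofReal_natCast,
    ← ENNReal.ofReal_mul (by positivity), ← ENNReal.ofReal_mul (by positivity)]
  congr 1
  cases n with
  | zero => simp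
  | succ n =>
    rw [Nat.add_sub_cancel, div_pow, pow_succ r, inv_pow]
    field_simp

section StarExp

open MvPowerSeries
open scoped ENNReal

/-- The weight `1 + k` on the monomial `ζ^k ζ̄^l`. -/
noncomputable def starWeight (k : Fin 2 →₀ ℕ) : ℝ≥0∞ := ENNReal.ofReal (1 + k 0)

/-- The value of the monomial `ζ^k ζ̄^l`. -/
noncomputable def starMonomial (ζ : ℂ) (k : Fin 2 →₀ ℕ) : ℂ :=
  ζ ^ k 0 * (starRingEnd ℂ ζ) ^ k 1

/-- The formal power series with coefficients `c k l`. -/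
def seriesOfCoeffs (c : ℕ → ℕ → ℂ) : MvPowerSeries (Fin 2) ℂ := fun k => c (k 0) (k 1)

/-- Bivariate exponents as pairs of natural numbers. -/
noncomputable def exponentEquiv : (Fin 2 →₀ ℕ) ≃ ℕ × ℕ :=
  Finsupp.equivFunOnFinite.trans (finTwoArrowEquiv ℕ)

/-- The double sequence of coefficients of a bivariate power series. -/
noncomputable def coeffsOfSeries (U : MvPowerSeries (Fin 2) ℂ) (k l : ℕ) : ℂ :=
  coeff (exponentEquiv.symm (k, l)) U

theorem exponentEquiv_apply (k : Fin 2 →₀ ℕ) : exponentEquiv k = (k 0, k 1) := rfl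

theorem seriesOfCoeffs_coeffsOfSeries (U : MvPowerSeries (Fin 2) ℂ) :
    seriesOfCoeffs (coeffsOfSeries U) = U := by
  ext k
  change coeff (exponentEquiv.symm (exponentEquiv k)) U = coeff k U
  rw [Equiv.symm_apply_apply]

theorem starWeight_zero : starWeight 0 = 1 := by simp [starWeight]

theorem one_le_starWeight (k : Fin 2 →₀ ℕ) : 1 ≤ starWeight k := by simp [starWeight]

theorem starWeight_add_le (k l : Fin 2 →₀ ℕ) :
    starWeight (k + l) ≤ starWeight k * starWeight l := by
  rw [starWeight, starWeight, starWeight, ← ENNReal.ofReal_mul (by positivity)]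
  refine ENNReal.ofReal_le_ofReal ?_
  have : (0 : ℝ) ≤ k 0 * l 0 := by positivity
  simp only [Finsupp.add_apply, Nat.cast_add]
  linarith

theorem starMonomial_zero (ζ : ℂ) : starMonomial ζ 0 = 1 := by simp [starMonomial]

theorem starMonomial_add (ζ : ℂ) (k l : Fin 2 →₀ ℕ) :
    starMonomial ζ (k + l) = starMonomial ζ k * starMonomial ζ l := by
  simp only [starMonomial, Finsupp.add_apply, pow_add]
  ring

theorem norm_starMonomial_le {ζ : ℂ} (hζ : ζ ∈ ball (0 : ℂ) 1) (k : Fin 2 →₀ ℕ) :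
    ‖starMonomial ζ k‖ ≤ 1 := by
  have h : ‖ζ‖ ≤ 1 := (mem_ball_zero_iff.1 hζ).le
  rw [starMonomial, norm_mul, norm_pow, norm_pow, RCLike.norm_conj]
  exact mul_le_one₀ (pow_le_one₀ (norm_nonneg _) h) (by positivity)
    (pow_le_one₀ (norm_nonneg _) h)

theorem weightedNorm_seriesOfCoeffs (c : ℕ → ℕ → ℂ) :
    weightedNorm starWeight (seriesOfCoeffs c) =
      ∑' kl : ℕ × ℕ, ENNReal.ofReal ((1 + kl.1 : ℝ) * ‖c kl.1 kl.2‖) := by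
  rw [← exponentEquiv.tsum_eq]
  refine tsum_congr fun k => ?_
  rw [exponentEquiv_apply, ENNReal.ofReal_mul (by positivity), ofReal_norm]
  rfl

theorem toReal_weightedNorm_seriesOfCoeffs (c : ℕ → ℕ → ℂ) :
    (weightedNorm starWeight (seriesOfCoeffs c)).toReal =
      ∑' kl : ℕ × ℕ, (1 + kl.1 : ℝ) * ‖c kl.1 kl.2‖ := by
  rw [weightedNorm_seriesOfCoeffs, ENNReal.tsum_toReal_eq fun _ => ENNReal.ofReal_ne_top]
  exact tsum_congr fun kl => ENNReal.toReal_ofReal (by positivity)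

theorem hasStarExp_iff {u : ℂ → ℂ} {c : ℕ → ℕ → ℂ} :
    HasStarExp u c ↔
      (∀ ζ ∈ ball (0 : ℂ) 1, u ζ = evalMonomials (starMonomial ζ) (seriesOfCoeffs c)) ∧
        weightedNorm starWeight (seriesOfCoeffs c) ≠ ∞ := by
  refine and_congr (forall₂_congr fun ζ _ => ?_) ?_
  · rw [← exponentEquiv.tsum_eq]
    simp only [exponentEquiv_apply, mul_assoc]
    rfl
  · rw [weightedNorm_seriesOfCoeffs]
    refine ⟨fun h => h.tsum_ofReal_ne_top, fun h => ?_⟩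
    refine (ENNReal.summable_toReal h).congr fun kl => ENNReal.toReal_ofReal (by positivity)

theorem weightedNorm_seriesOfCoeffs_lt {u : ℂ → ℂ} {c : ℕ → ℕ → ℂ} {r : ℝ}
    (hu : HasStarExp u c) (h : (∑' kl : ℕ × ℕ, (1 + kl.1 : ℝ) * ‖c kl.1 kl.2‖) < r) :
    weightedNorm starWeight (seriesOfCoeffs c) < ENNReal.ofReal r := by
  rwa [← toReal_weightedNorm_seriesOfCoeffs, ← ENNReal.lt_ofReal_iff_toReal_lt] at h
  exact (hasStarExp_iff.1 hu).2

theorem HasStarExp.norm_lt {u : ℂ → ℂ} {c : ℕ → ℕ → ℂ} {r : ℝ} (hr : 0 < r)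
    (hu : HasStarExp u c) (h : (∑' kl : ℕ × ℕ, (1 + kl.1 : ℝ) * ‖c kl.1 kl.2‖) < r)
    {ζ : ℂ} (hζ : ζ ∈ ball (0 : ℂ) 1) : ‖u ζ‖ < r := by
  rw [(hasStarExp_iff.1 hu).1 ζ hζ, ← ENNReal.ofReal_lt_ofReal_iff hr, ofReal_norm]
  exact (enorm_evalMonomials_le one_le_starWeight (norm_starMonomial_le hζ) _).trans_lt
    (weightedNorm_seriesOfCoeffs_lt hu h)

variable {a : ℕ × ℕ → ℂ} {R r C : ℝ}

theorem tsum_enorm_mul_weightedNorm_monomial_ne_top (hr : 0 < r) (hrR : r < R)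
    (ha : ∀ p, ‖a p‖ₑ ≤ ENNReal.ofReal C * ENNReal.ofReal R⁻¹ ^ (p.1 + p.2))
    {X Y : MvPowerSeries (Fin 2) ℂ} (hX : weightedNorm starWeight X ≤ ENNReal.ofReal r)
    (hY : weightedNorm starWeight Y ≤ ENNReal.ofReal r) :
    ∑' p, ‖a p‖ₑ * weightedNorm starWeight (X ^ p.1 * Y ^ p.2) ≠ ∞ := by
  set q := ENNReal.ofReal R⁻¹
  set ρ := ENNReal.ofReal r
  have hbound :
      ∑' p : ℕ × ℕ, ENNReal.ofReal C * ((q ^ p.1 * ρ ^ p.1) * (q ^ p.2 * ρ ^ p.2)) ≠ ∞ := by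
    rw [ENNReal.tsum_mul_left,
      ENNReal.tsum_mul_tsum_prod (fun m => q ^ m * ρ ^ m) (fun n => q ^ n * ρ ^ n),
      ENNReal.tsum_ofReal_inv_pow_mul hr hrR]
    finiteness
  refine ne_top_of_le_ne_top hbound (ENNReal.tsum_le_tsum fun p => ?_)
  refine (mul_le_mul' (ha p) ((weightedNorm_mul_le starWeight_add_le _ _).trans (mul_le_mul'
    (weightedNorm_pow_le starWeight_zero starWeight_add_le hX p.1)
    (weightedNorm_pow_le starWeight_zero starWeight_add_le hY p.2)))).trans_eq ?_
  rw [pow_add]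
  ring

theorem tsum_enorm_mul_weightedNorm_monomial_sub_le (hr : 0 < r) (hrR : r < R)
    (ha : ∀ p, ‖a p‖ₑ ≤ ENNReal.ofReal C * ENNReal.ofReal R⁻¹ ^ (p.1 + p.2))
    {X Y X' Y' : MvPowerSeries (Fin 2) ℂ}
    (hX : weightedNorm starWeight X ≤ ENNReal.ofReal r)
    (hY : weightedNorm starWeight Y ≤ ENNReal.ofReal r)
    (hX' : weightedNorm starWeight X' ≤ ENNReal.ofReal r)
    (hY' : weightedNorm starWeight Y' ≤ ENNReal.ofReal r) :
    ∑' p, ‖a p‖ₑ * weightedNorm starWeight (X ^ p.1 * Y ^ p.2 - X' ^ p.1 * Y' ^ p.2) ≤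
      ENNReal.ofReal (R ^ 2 / (R - r) ^ 3) * ENNReal.ofReal C *
        (weightedNorm starWeight (X - X') + weightedNorm starWeight (Y - Y')) := by
  set q := ENNReal.ofReal R⁻¹
  set ρ := ENNReal.ofReal r
  set A := weightedNorm starWeight (X - X')
  set B := weightedNorm starWeight (Y - Y')
  have hR : 0 < R := hr.trans hrR
  have hRr : 0 < R - r := sub_pos.2 hrR
  calc _ ≤ ∑' p : ℕ × ℕ, (ENNReal.ofReal C * A * ((q ^ p.1 * (p.1 * ρ ^ (p.1 - 1))) *
            (q ^ p.2 * ρ ^ p.2)) +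
          ENNReal.ofReal C * B * ((q ^ p.1 * ρ ^ p.1) * (q ^ p.2 * (p.2 * ρ ^ (p.2 - 1))))) := by
        refine ENNReal.tsum_le_tsum fun p => ?_
        refine (mul_le_mul' (ha p) (weightedNorm_monomial_sub_le starWeight_zero starWeight_add_le
          hX hY hX' hY' p.1 p.2)).trans_eq ?_
        rw [pow_add]
        ring
    _ = ENNReal.ofReal C * A * (ENNReal.ofReal (R / (R - r) ^ 2) * ENNReal.ofReal (R / (R - r))) +
        ENNReal.ofReal C * B *
          (ENNReal.ofReal (R / (R - r)) * ENNReal.ofReal (R / (R - r) ^ 2)) := by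
        rw [ENNReal.tsum_add, ENNReal.tsum_mul_left, ENNReal.tsum_mul_left,
          ENNReal.tsum_mul_tsum_prod (fun m : ℕ => q ^ m * (m * ρ ^ (m - 1)))
            (fun n => q ^ n * ρ ^ n),
          ENNReal.tsum_mul_tsum_prod (fun m => q ^ m * ρ ^ m)
            (fun n : ℕ => q ^ n * (n * ρ ^ (n - 1))),
          ENNReal.tsum_ofReal_inv_pow_mul hr hrR, ENNReal.tsum_ofReal_inv_pow_mul_deriv hr hrR]
    _ = _ := by
        have hK : R ^ 2 / (R - r) ^ 3 = R / (R - r) ^ 2 * (R / (R - r)) := by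
          field_simp
        rw [hK, ENNReal.ofReal_mul (by positivity)]
        ring

theorem hasStarExp_comp {F : ℂ × ℂ → ℂ} (hr : 0 < r) (hrR : r < R)
    (ha : ∀ p, ‖a p‖ₑ ≤ ENNReal.ofReal C * ENNReal.ofReal R⁻¹ ^ (p.1 + p.2))
    (hF : ∀ z w : ℂ, ‖z‖ < R → ‖w‖ < R → F (z, w) = ∑' p : ℕ × ℕ, a p * (z ^ p.1 * w ^ p.2))
    {f g : ℂ → ℂ} {cf cg : ℕ → ℕ → ℂ} (hf : HasStarExp f cf) (hg : HasStarExp g cg)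
    (hfr : (∑' kl : ℕ × ℕ, (1 + kl.1 : ℝ) * ‖cf kl.1 kl.2‖) < r)
    (hgr : (∑' kl : ℕ × ℕ, (1 + kl.1 : ℝ) * ‖cg kl.1 kl.2‖) < r) :
    HasStarExp (fun ζ => F (f ζ, g ζ)) (coeffsOfSeries
      (tsumSMul a fun p => seriesOfCoeffs cf ^ p.1 * seriesOfCoeffs cg ^ p.2)) := by
  have hX := (weightedNorm_seriesOfCoeffs_lt hf hfr).le
  have hY := (weightedNorm_seriesOfCoeffs_lt hg hgr).le
  obtain ⟨hfE, hfT⟩ := hasStarExp_iff.1 hf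
  obtain ⟨hgE, hgT⟩ := hasStarExp_iff.1 hg
  have hfin := tsum_enorm_mul_weightedNorm_monomial_ne_top hr hrR ha hX hY
  rw [hasStarExp_iff, seriesOfCoeffs_coeffsOfSeries]
  refine ⟨fun ζ hζ => ?_, ne_top_of_le_ne_top hfin weightedNorm_tsumSMul_le⟩
  have hχ := norm_starMonomial_le hζ
  rw [evalMonomials_tsumSMul one_le_starWeight hχ hfin,
    hF _ _ ((hf.norm_lt hr hfr hζ).trans hrR) ((hg.norm_lt hr hgr hζ).trans hrR)]
  refine tsum_congr fun p => ?_
  rw [evalMonomials_mul one_le_starWeight hχ (starMonomial_add ζ),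
    evalMonomials_pow one_le_starWeight starWeight_zero starWeight_add_le hχ
      (starMonomial_zero ζ) (starMonomial_add ζ) hfT,
    evalMonomials_pow one_le_starWeight starWeight_zero starWeight_add_le hχ
      (starMonomial_zero ζ) (starMonomial_add ζ) hgT, hfE ζ hζ, hgE ζ hζ]
  · exact ne_top_of_le_ne_top (ENNReal.pow_ne_top hfT)
      (weightedNorm_pow_le starWeight_zero starWeight_add_le le_rfl _)
  · exact ne_top_of_le_ne_top (ENNReal.pow_ne_top hgT)
      (weightedNorm_pow_le starWeight_zero starWeight_add_le le_rfl _)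

end StarExp

/-- Lemma 3.2, `crucial_lemma`, part (ii): Lipschitz continuity of
composition, in the case `k = 2`. -/
theorem stmt13 (R r : ℝ) (hR : 0 < R) (hr : 0 < r) (hrR : r < R)
    (F : ℂ × ℂ → ℂ)
    (hFd : DifferentiableOn ℂ F {zw | ‖zw.1‖ < R ∧ ‖zw.2‖ < R})
    (hFc : ContinuousOn F {zw | ‖zw.1‖ ≤ R ∧ ‖zw.2‖ ≤ R})
    (C : ℝ) (hC : ∀ zw : ℂ × ℂ, ‖zw.1‖ ≤ R → ‖zw.2‖ ≤ R → ‖F zw‖ ≤ C)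
    (f g f' g' : ℂ → ℂ) (cf cg cf' cg' : ℕ → ℕ → ℂ)
    (hf : HasStarExp f cf) (hg : HasStarExp g cg)
    (hf' : HasStarExp f' cf') (hg' : HasStarExp g' cg')
    (hfr : (∑' kl : ℕ × ℕ, (1 + kl.1 : ℝ) * ‖cf kl.1 kl.2‖) < r)
    (hgr : (∑' kl : ℕ × ℕ, (1 + kl.1 : ℝ) * ‖cg kl.1 kl.2‖) < r)
    (hfr' : (∑' kl : ℕ × ℕ, (1 + kl.1 : ℝ) * ‖cf' kl.1 kl.2‖) < r)
    (hgr' : (∑' kl : ℕ × ℕ, (1 + kl.1 : ℝ) * ‖cg' kl.1 kl.2‖) < r) :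
    ∃ h h' : ℕ → ℕ → ℂ,
      HasStarExp (fun ζ => F (f ζ, g ζ)) h ∧
      HasStarExp (fun ζ => F (f' ζ, g' ζ)) h' ∧
      (∑' kl : ℕ × ℕ, (1 + kl.1 : ℝ) * ‖h kl.1 kl.2 - h' kl.1 kl.2‖) ≤
        (R ^ 2 / (R - r) ^ 3) * C *
          ((∑' kl : ℕ × ℕ, (1 + kl.1 : ℝ) * ‖cf kl.1 kl.2 - cf' kl.1 kl.2‖) +
           (∑' kl : ℕ × ℕ, (1 + kl.1 : ℝ) * ‖cg kl.1 kl.2 - cg' kl.1 kl.2‖)) := by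
  have hC0 : 0 ≤ C := (norm_nonneg _).trans (hC 0 (by simpa using hR.le) (by simpa using hR.le))
  obtain ⟨a, haC, haF⟩ := exists_doublePowerSeries hR hFd fun zw h₁ h₂ => hC zw h₁.le h₂.le
  have ha : ∀ p, ‖a p‖ₑ ≤ ENNReal.ofReal C * ENNReal.ofReal R⁻¹ ^ (p.1 + p.2) := fun p => by
    rw [← ENNReal.ofReal_pow (by positivity), ← ENNReal.ofReal_mul hC0, ← ofReal_norm]
    exact ENNReal.ofReal_le_ofReal (haC p)
  have hX := (weightedNorm_seriesOfCoeffs_lt hf hfr).le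
  have hY := (weightedNorm_seriesOfCoeffs_lt hg hgr).le
  have hX' := (weightedNorm_seriesOfCoeffs_lt hf' hfr').le
  have hY' := (weightedNorm_seriesOfCoeffs_lt hg' hgr').le
  refine ⟨_, _, hasStarExp_comp hr hrR ha haF hf hg hfr hgr,
    hasStarExp_comp hr hrR ha haF hf' hg' hfr' hgr', ?_⟩
  have hsub : ∀ c c' : ℕ → ℕ → ℂ, (∑' kl : ℕ × ℕ, (1 + kl.1 : ℝ) * ‖c kl.1 kl.2 - c' kl.1 kl.2‖) =
      (MvPowerSeries.weightedNorm starWeight (seriesOfCoeffs c - seriesOfCoeffs c')).toReal :=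
    fun c c' => (toReal_weightedNorm_seriesOfCoeffs fun k l => c k l - c' k l).symm
  have hfin : ∀ {X X' : MvPowerSeries (Fin 2) ℂ},
      MvPowerSeries.weightedNorm starWeight X ≤ ENNReal.ofReal r →
      MvPowerSeries.weightedNorm starWeight X' ≤ ENNReal.ofReal r →
      MvPowerSeries.weightedNorm starWeight (X - X') ≠ ⊤ := fun h h' =>
    ne_top_of_le_ne_top (by finiteness)
      ((MvPowerSeries.weightedNorm_sub_le _ _).trans (add_le_add h h'))
  have hK : 0 ≤ R ^ 2 / (R - r) ^ 3 := by
    have := sub_pos.2 hrR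
    positivity
  have hA := hfin hX hX'
  have hB := hfin hY hY'
  rw [hsub, hsub, hsub, seriesOfCoeffs_coeffsOfSeries, seriesOfCoeffs_coeffsOfSeries,
    MvPowerSeries.tsumSMul_sub one_le_starWeight
      (tsum_enorm_mul_weightedNorm_monomial_ne_top hr hrR ha hX hY)
      (tsum_enorm_mul_weightedNorm_monomial_ne_top hr hrR ha hX' hY'),
    ← ENNReal.toReal_add hA hB]
  refine (ENNReal.toReal_mono (by finiteness) (MvPowerSeries.weightedNorm_tsumSMul_le.trans
    (tsum_enorm_mul_weightedNorm_monomial_sub_le hr hrR ha hX hY hX' hY'))).trans_eq ?_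
  rw [ENNReal.toReal_mul, ENNReal.toReal_mul, ENNReal.toReal_ofReal hK, ENNReal.toReal_ofReal hC0]
end
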